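/- arXiv:math/0212272 — 2 statements merged into one kernel-verified Lean document; each statement's English description precedes it below -/
import Mathlib

section
/- The level-p Yangian Y_p(gl_2) is free as a left module (and as a right module) over the subalgebra Γ generated by t_{22}^{(1)}, ..., t_{22}^{(p)} and the quantum determinant coefficients d_1, ..., d_{2p}; moreover Γ is a direct summand of Y_p(gl_2) as a Γ-module. -/
open Polynomial

/-- Generator index for the level-`p` Yangian: `(i, j, k)` with `k : Fin p` encoding
the superscript `k+1`. -/
abbrev YGen (p : ℕ) := Fin 2 × Fin 2 × Fin p

/-- The free-algebra version of the generator `t_{ij}^{(r)}`, with the conventions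
`t_{ij}^{(0)} = δ_{ij}` and `t_{ij}^{(r)} = 0` for `r > p`. -/
noncomputable def tF (K : Type) [Field K] (p : ℕ) (i j : Fin 2) (r : ℕ) :
    FreeAlgebra K (YGen p) :=
  if h0 : r = 0 then (if i = j then 1 else 0)
  else if h : r ≤ p then FreeAlgebra.ι K (i, j, (⟨r - 1, by omega⟩ : Fin p)) else 0

/-- The defining relations of the level-`p` Yangian:
`[t_{ij}^{(r)}, t_{kl}^{(s)}] = Σ_{a=1}^{min(r,s)} (t_{kj}^{(a-1)} t_{il}^{(r+s-a)} -
t_{kj}^{(r+s-a)} t_{il}^{(a-1)})`. -/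
inductive YRel (K : Type) [Field K] (p : ℕ) :
    FreeAlgebra K (YGen p) → FreeAlgebra K (YGen p) → Prop
  | rel (i j k l : Fin 2) (r s : ℕ) (hr : 1 ≤ r) (hr' : r ≤ p) (hs : 1 ≤ s) (hs' : s ≤ p) :
      YRel K p (tF K p i j r * tF K p k l s - tF K p k l s * tF K p i j r)
        (∑ a ∈ Finset.Icc 1 (min r s),
          (tF K p k j (a - 1) * tF K p i l (r + s - a)
            - tF K p k j (r + s - a) * tF K p i l (a - 1)))

/-- The level-`p` Yangian `Y_p(gl_2)`. -/
abbrev Yp (K : Type) [Field K] (p : ℕ) := RingQuot (YRel K p)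

/-- The generator `t_{ij}^{(r)}` of `Y_p(gl_2)` (matrix indices `0,1` stand for `1,2`). -/
noncomputable def tY (K : Type) [Field K] (p : ℕ) (i j : Fin 2) (r : ℕ) : Yp K p :=
  RingQuot.mkAlgHom K (YRel K p) (tF K p i j r)

/-- The generating polynomial `T_{ij}(u) = δ_{ij} u^p + Σ_{k=1}^p t_{ij}^{(k)} u^{p-k}`. -/
noncomputable def TY (K : Type) [Field K] (p : ℕ) (i j : Fin 2) : Polynomial (Yp K p) :=
  (if i = j then X ^ p else 0) + ∑ k ∈ Finset.Icc 1 p, C (tY K p i j k) * X ^ (p - k)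

/-- The quantum determinant `D(u) = T_{11}(u) T_{22}(u-1) - T_{21}(u) T_{12}(u-1)`. -/
noncomputable def DY (K : Type) [Field K] (p : ℕ) : Polynomial (Yp K p) :=
  TY K p 0 0 * (TY K p 1 1).comp (X - 1) - TY K p 1 0 * (TY K p 0 1).comp (X - 1)

/-- The coefficient `d_i` of the quantum determinant: `D(u) = u^{2p} + Σ_i d_i u^{2p-i}`. -/
noncomputable def dY (K : Type) [Field K] (p : ℕ) (i : ℕ) : Yp K p :=
  (DY K p).coeff (2 * p - i)

/-- The commutative subalgebra `Γ` generated by `t_{22}^{(1)},…,t_{22}^{(p)}` and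
`d_1,…,d_{2p}`. -/
noncomputable def Gam (K : Type) [Field K] (p : ℕ) : Subalgebra K (Yp K p) :=
  Algebra.adjoin K
    ({x | ∃ k ∈ Finset.Icc 1 p, x = tY K p 1 1 k} ∪
     {x | ∃ i ∈ Finset.Icc 1 (2 * p), x = dY K p i})

namespace LevelYangian

section Filtered

variable {K G Y : Type*} [Field K] [Ring Y] [Algebra K Y] (w : G → ℕ) (t : G → Y)

/-- The span of the products of generators of total weight less than `N`. -/
def filt (K : Type*) {G Y : Type*} [Field K] [Ring Y] [Algebra K Y] (w : G → ℕ) (t : G → Y)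
    (N : ℕ) : Submodule K Y :=
  Submodule.span K {y | ∃ l : List G, (l.map w).sum < N ∧ y = (l.map t).prod}

variable {w t}

lemma prod_mem_filt {l : List G} {N : ℕ} (h : (l.map w).sum < N) :
    (l.map t).prod ∈ filt K w t N :=
  Submodule.subset_span ⟨l, h, rfl⟩

lemma filt_mono {M N : ℕ} (h : M ≤ N) : filt K w t M ≤ filt K w t N :=
  Submodule.span_mono fun _ ⟨l, hl, e⟩ => ⟨l, hl.trans_le h, e⟩

lemma filt_mul_of_add {a b c : ℕ} (h : ∀ m n, m < a → n < b → m + n < c) {x y : Y}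
    (hx : x ∈ filt K w t a) (hy : y ∈ filt K w t b) : x * y ∈ filt K w t c := by
  have : filt K w t a * filt K w t b ≤ filt K w t c := by
    rw [filt, filt, Submodule.span_mul_span, Submodule.span_le]
    rintro _ ⟨_, ⟨l, hl, rfl⟩, _, ⟨l', hl', rfl⟩, rfl⟩
    have := prod_mem_filt (K := K) (w := w) (t := t) (l := l ++ l') (N := c)
      (by simpa using h _ _ hl hl')
    simpa using this
  exact this (Submodule.mul_mem_mul hx hy)

lemma one_mem_filt : (1 : Y) ∈ filt K w t 1 := by
  simpa using prod_mem_filt (K := K) (w := w) (t := t) (l := []) (N := 1) (by simp)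

lemma gen_mem_filt (g : G) : t g ∈ filt K w t (w g + 1) := by
  simpa using prod_mem_filt (K := K) (w := w) (t := t) (l := [g]) (N := w g + 1) (by simp)

/-- The linear map sending a monomial to an ordered product of generators. -/
noncomputable def ordMap (K : Type*) {G Y : Type*} [Field K] [Ring Y] [Algebra K Y] (t : G → Y) :
    MvPolynomial G K →ₗ[K] Y :=
  (MvPolynomial.basisMonomials G K).constr K
    fun e => ((Finsupp.toMultiset e).toList.map t).prod

lemma ordMap_monomial (e : G →₀ ℕ) :
    ordMap K t (MvPolynomial.monomial e 1) = ((Finsupp.toMultiset e).toList.map t).prod := by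
  have := (MvPolynomial.basisMonomials G K).constr_basis K
    (fun e => ((Finsupp.toMultiset e).toList.map t).prod) e
  simpa [ordMap] using this

lemma weight_eq_sum (e : G →₀ ℕ) :
    Finsupp.weight w e = ((Finsupp.toMultiset e).toList.map w).sum := by
  have h : ((Finsupp.toMultiset e).toList.map w).sum = ((Finsupp.toMultiset e).map w).sum := by
    conv_rhs => rw [← Multiset.coe_toList (Finsupp.toMultiset e)]
    simp
  rw [h]
  induction e using Finsupp.induction_linear with
  | zero => simp
  | add f g hf hg =>
    rw [map_add, map_add, Multiset.map_add, Multiset.sum_add, hf, hg]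
    all_goals
      conv_lhs => rw [← Multiset.coe_toList (Finsupp.toMultiset _)]
      simp [-Multiset.coe_toList]
  | single a n => simp [Finsupp.weight_apply, Finsupp.toMultiset_single, Multiset.map_nsmul,
      Multiset.sum_nsmul]

lemma perm_sub_mem_filt (hc : ∀ g h, t g * t h - t h * t g ∈ filt K w t (w g + w h))
    {l l' : List G} (h : l.Perm l') :
    (l.map t).prod - (l'.map t).prod ∈ filt K w t (l.map w).sum := by
  induction h with
  | nil => simp
  | @cons x l₁ l₂ h ih =>
    have := filt_mul_of_add (c := (List.map w (x :: l₁)).sum)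
      (fun m n hm hn => by rw [List.map_cons, List.sum_cons]; omega)
      (gen_mem_filt (K := K) (w := w) (t := t) x) ih
    simpa [mul_sub] using this
  | swap x y l =>
    have := filt_mul_of_add (c := w y + w x + (l.map w).sum) (fun m n hm hn => by omega)
      (hc y x) (prod_mem_filt (K := K) (w := w) (t := t) (l := l) (Nat.lt_succ_self _))
    simpa [sub_mul, mul_assoc, add_assoc] using this
  | trans h1 h2 ih1 ih2 =>
    rw [← (h1.map w).sum_eq] at ih2
    simpa using add_mem ih1 ih2

lemma list_prod_X [DecidableEq G] (l : List G) :
    (l.map (MvPolynomial.X : G → MvPolynomial G K)).prod =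
      MvPolynomial.monomial (Multiset.toFinsupp (l : Multiset G)) 1 := by
  induction l with
  | nil => simp
  | cons a l ih =>
    rw [List.map_cons, List.prod_cons, ih, ← Multiset.cons_coe, ← Multiset.singleton_add,
      map_add, Multiset.toFinsupp_singleton, MvPolynomial.X, MvPolynomial.monomial_mul, one_mul]

lemma prod_sub_ordMap_mem (hc : ∀ g h, t g * t h - t h * t g ∈ filt K w t (w g + w h))
    (l : List G) :
    (l.map t).prod - ordMap K t ((l.map MvPolynomial.X).prod) ∈ filt K w t (l.map w).sum := by
  classical
  rw [list_prod_X, ordMap_monomial]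
  apply perm_sub_mem_filt hc
  rw [← Multiset.coe_eq_coe, Multiset.coe_toList, Multiset.toFinsupp_toMultiset]

/-- Polynomials that are weighted homogeneous of weight `N`. -/
abbrev hom (K : Type*) {G : Type*} [Field K] (w : G → ℕ) (N : ℕ) :
    Submodule K (MvPolynomial G K) :=
  MvPolynomial.weightedHomogeneousSubmodule K w N

lemma hom_eq_span (N : ℕ) : hom K w N =
    Submodule.span K {f | ∃ l : List G, (l.map w).sum = N ∧
      f = (l.map (MvPolynomial.X : G → MvPolynomial G K)).prod} := by
  classical
  apply le_antisymm
  · intro f hf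
    rw [MvPolynomial.as_sum f]
    refine Submodule.sum_mem _ fun e he => ?_
    have hw := hf (MvPolynomial.mem_support_iff.1 he)
    rw [← mul_one (MvPolynomial.coeff e f), ← smul_eq_mul, ← MvPolynomial.smul_monomial]
    refine Submodule.smul_mem _ _ (Submodule.subset_span ⟨(Finsupp.toMultiset e).toList, ?_, ?_⟩)
    · rw [← weight_eq_sum, hw]
    · rw [list_prod_X, Multiset.coe_toList, Finsupp.toMultiset_toFinsupp]
  · rw [Submodule.span_le]
    rintro _ ⟨l, rfl, rfl⟩
    induction l with
    | nil => simpa using MvPolynomial.isWeightedHomogeneous_one K w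
    | cons a l ih => simpa using (MvPolynomial.isWeightedHomogeneous_X K w a).mul ih

/-- `y` is congruent to an ordered lift of the weight `N` polynomial `f` modulo smaller weight. -/
def Lifts (w : G → ℕ) (t : G → Y) (N : ℕ) (y : Y) (f : MvPolynomial G K) : Prop :=
  f ∈ hom K w N ∧ y - ordMap K t f ∈ filt K w t N

lemma lifts_prod (hc : ∀ g h, t g * t h - t h * t g ∈ filt K w t (w g + w h)) (l : List G) :
    Lifts w t (l.map w).sum (l.map t).prod
      ((l.map (MvPolynomial.X : G → MvPolynomial G K)).prod) :=
  ⟨by rw [hom_eq_span]; exact Submodule.subset_span ⟨l, rfl, rfl⟩, prod_sub_ordMap_mem hc l⟩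

lemma Lifts.add {N : ℕ} {y z : Y} {f g : MvPolynomial G K} (h : Lifts w t N y f)
    (h' : Lifts w t N z g) : Lifts w t N (y + z) (f + g) := by
  refine ⟨add_mem h.1 h'.1, ?_⟩
  rw [map_add, add_sub_add_comm]
  exact add_mem h.2 h'.2

lemma Lifts.smul {N : ℕ} {y : Y} {f : MvPolynomial G K} (h : Lifts w t N y f) (c : K) :
    Lifts w t N (c • y) (c • f) := by
  refine ⟨Submodule.smul_mem _ _ h.1, ?_⟩
  rw [map_smul, ← smul_sub]
  exact Submodule.smul_mem _ _ h.2

lemma lifts_zero {N : ℕ} {y : Y} (hy : y ∈ filt K w t N) :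
    Lifts w t N y (0 : MvPolynomial G K) :=
  ⟨zero_mem _, by simpa using hy⟩

lemma Lifts.neg {N : ℕ} {y : Y} {f : MvPolynomial G K} (h : Lifts w t N y f) :
    Lifts w t N (-y) (-f) := by
  simpa using h.smul (-1)

lemma Lifts.sub {N : ℕ} {y z : Y} {f g : MvPolynomial G K} (h : Lifts w t N y f)
    (h' : Lifts w t N z g) : Lifts w t N (y - z) (f - g) := by
  simpa [sub_eq_add_neg] using h.add h'.neg

lemma Lifts.sum {ι : Type*} (s : Finset ι) {N : ℕ} {y : ι → Y} {f : ι → MvPolynomial G K}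
    (h : ∀ i ∈ s, Lifts w t N (y i) (f i)) : Lifts w t N (∑ i ∈ s, y i) (∑ i ∈ s, f i) := by
  refine ⟨Submodule.sum_mem _ fun i hi => (h i hi).1, ?_⟩
  rw [map_sum, ← Finset.sum_sub_distrib]
  exact Submodule.sum_mem _ fun i hi => (h i hi).2

lemma exists_lift (hc : ∀ g h, t g * t h - t h * t g ∈ filt K w t (w g + w h))
    {N : ℕ} {f : MvPolynomial G K} (hf : f ∈ hom K w N) :
    ordMap K t f ∈ filt K w t (N + 1) := by
  rw [hom_eq_span] at hf
  induction hf using Submodule.span_induction with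
  | mem x hx =>
    obtain ⟨l, rfl, rfl⟩ := hx
    have := sub_mem (prod_mem_filt (K := K) (w := w) (t := t) (l := l) (Nat.lt_succ_self _))
      (filt_mono (Nat.le_succ _) (prod_sub_ordMap_mem (K := K) hc l))
    simpa using this
  | zero => simp
  | add x y _ _ hx hy => rw [map_add]; exact add_mem hx hy
  | smul a x _ hx => rw [map_smul]; exact Submodule.smul_mem _ _ hx

lemma ordMap_mul_sub_mem (hc : ∀ g h, t g * t h - t h * t g ∈ filt K w t (w g + w h))
    {M N : ℕ} {f g : MvPolynomial G K} (hf : f ∈ hom K w M) (hg : g ∈ hom K w N) :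
    ordMap K t f * ordMap K t g - ordMap K t (f * g) ∈ filt K w t (M + N) := by
  have hf' := hf
  rw [hom_eq_span] at hf
  induction hf using Submodule.span_induction with
  | zero => simp
  | add x y hx0 hy0 hx hy =>
    rw [← hom_eq_span] at hx0 hy0
    have := add_mem (hx hx0) (hy hy0)
    rw [map_add, add_mul, add_mul, map_add]
    convert this using 1; abel
  | smul a x hx0 hx =>
    rw [← hom_eq_span] at hx0
    have := Submodule.smul_mem _ a (hx hx0)
    simpa [smul_sub] using this
  | mem x hx =>
    obtain ⟨l, rfl, rfl⟩ := hx
    have hg' := hg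
    rw [hom_eq_span] at hg
    induction hg using Submodule.span_induction with
    | zero => simp
    | add x y hx0 hy0 hx hy =>
      rw [← hom_eq_span] at hx0 hy0
      have := add_mem (hx hx0) (hy hy0)
      rw [map_add, mul_add, mul_add, map_add]
      convert this using 1; abel
    | smul a x hx0 hx =>
      rw [← hom_eq_span] at hx0
      have := Submodule.smul_mem _ a (hx hx0)
      simpa [smul_sub] using this
    | mem x hx =>
      obtain ⟨l', rfl, rfl⟩ := hx
      have h1 := prod_sub_ordMap_mem (K := K) hc l
      have h2 := prod_sub_ordMap_mem (K := K) hc l'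
      have h3 := prod_sub_ordMap_mem (K := K) hc (l ++ l')
      have h4 := exists_lift hc hf'
      have h5 := prod_mem_filt (K := K) (w := w) (t := t) (l := l') (Nat.lt_succ_self _)
      have h6 := filt_mul_of_add (c := (l.map w).sum + (l'.map w).sum)
        (fun m n hm hn => by omega) h1 h5
      have h7 := filt_mul_of_add (c := (l.map w).sum + (l'.map w).sum)
        (fun m n hm hn => by omega) h4 h2
      simp only [List.map_append, List.prod_append, List.sum_append] at h3
      have := sub_mem h3 (add_mem h6 h7)
      convert this using 1
      noncomm_ring

lemma Lifts.mul (hc : ∀ g h, t g * t h - t h * t g ∈ filt K w t (w g + w h))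
    {M N : ℕ} {y z : Y} {f g : MvPolynomial G K}
    (h : Lifts w t M y f) (h' : Lifts w t N z g) : Lifts w t (M + N) (y * z) (f * g) := by
  refine ⟨MvPolynomial.IsWeightedHomogeneous.mul h.1 h'.1, ?_⟩
  have h1 := ordMap_mul_sub_mem hc h.1 h'.1
  have h2 := filt_mul_of_add (c := M + N) (fun m n hm hn => by omega) (exists_lift hc h.1) h'.2
  have h3 := filt_mul_of_add (c := M + N) (fun m n hm hn => by omega) h.2 (exists_lift hc h'.1)
  have h4 := filt_mul_of_add (c := M + N) (fun m n hm hn => by omega) h.2 h'.2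
  convert add_mem (add_mem h1 h2) (add_mem h3 h4) using 1
  noncomm_ring

lemma Lifts.pow (hc : ∀ g h, t g * t h - t h * t g ∈ filt K w t (w g + w h))
    {M : ℕ} {y : Y} {f : MvPolynomial G K} (h : Lifts w t M y f) (k : ℕ) :
    Lifts w t (k * M) (y ^ k) (f ^ k) := by
  induction k with
  | zero => simpa using lifts_prod (K := K) hc []
  | succ k ih => simpa [pow_succ, add_mul] using ih.mul hc h

lemma filt_eq_map (hc : ∀ g h, t g * t h - t h * t g ∈ filt K w t (w g + w h)) (N : ℕ)
    {y : Y} (hy : y ∈ filt K w t N) :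
    ∃ f : MvPolynomial G K, (∀ M, N ≤ M → MvPolynomial.weightedHomogeneousComponent w M f = 0) ∧
      y = ordMap K t f := by
  classical
  induction N generalizing y with
  | zero =>
    refine ⟨0, by simp, ?_⟩
    have : filt K w t 0 = ⊥ := by simp [filt]
    simpa [this] using hy
  | succ N ih =>
    induction hy using Submodule.span_induction with
    | zero => exact ⟨0, by simp⟩
    | add x y _ _ hx hy =>
      obtain ⟨f, hf, rfl⟩ := hx
      obtain ⟨g, hg, rfl⟩ := hy
      exact ⟨f + g, fun M hM => by simp [hf M hM, hg M hM], by simp⟩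
    | smul a x _ hx =>
      obtain ⟨f, hf, rfl⟩ := hx
      exact ⟨a • f, fun M hM => by simp [hf M hM], by simp⟩
    | mem x hx =>
      obtain ⟨l, hl, rfl⟩ := hx
      have h1 := prod_sub_ordMap_mem (K := K) hc l
      obtain ⟨f, hf, hfe⟩ := ih (filt_mono (Nat.lt_succ_iff.1 hl) h1)
      refine ⟨f + (l.map MvPolynomial.X).prod, fun M hM => ?_, ?_⟩
      · rw [map_add, hf M (by omega), zero_add]
        exact MvPolynomial.IsWeightedHomogeneous.weightedHomogeneousComponent_ne M
          (lifts_prod (K := K) hc l).1 (by omega)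
      · rw [map_add, ← hfe]; simp

theorem linearIndependent_of_lifts
    (hc : ∀ g h, t g * t h - t h * t g ∈ filt K w t (w g + w h))
    (hinj : Function.Injective (ordMap K t)) {ι : Type*} {y : ι → Y} {f : ι → MvPolynomial G K}
    {n : ι → ℕ} (hl : ∀ i, Lifts w t (n i) (y i) (f i)) (hf : LinearIndependent K f) :
    LinearIndependent K y := by
  classical
  rw [linearIndependent_iff']
  intro s c hs
  by_contra! hne
  obtain ⟨i₀, hi₀, hci₀⟩ := hne
  obtain ⟨j, hj, hmax⟩ := Finset.exists_max_image (s.filter fun i => c i ≠ 0) n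
    ⟨i₀, by simp [hi₀, hci₀]⟩
  rw [Finset.mem_filter] at hj
  have hle : ∀ i ∈ s, c i ≠ 0 → n i ≤ n j := fun i hi h => hmax i (by simp [hi, h])
  have h1 : Lifts w t (n j) (∑ i ∈ s, c i • y i)
      (∑ i ∈ s, if n i = n j then c i • f i else 0) := by
    refine Lifts.sum s fun i hi => ?_
    by_cases hc0 : c i = 0
    · simpa [hc0] using lifts_zero (K := K) (w := w) (t := t) (N := n j) (zero_mem _)
    split_ifs with hij
    · rw [← hij]; exact (hl i).smul _
    · apply lifts_zero
      have hlt : n i < n j := lt_of_le_of_ne (hle i hi hc0) hij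
      have := add_mem (filt_mono hlt.le (hl i).2) (filt_mono hlt (exists_lift hc (hl i).1))
      exact Submodule.smul_mem _ _ (by simpa using this)
  rw [hs] at h1
  obtain ⟨g, hg, hge⟩ := filt_eq_map hc _ h1.2
  rw [zero_sub, ← map_neg] at hge
  have h2 := hinj hge
  have h3 : ∑ i ∈ s, (if n i = n j then c i • f i else 0) = 0 := by
    have h4 := (MvPolynomial.IsWeightedHomogeneous.weightedHomogeneousComponent_same
      ((hom K w (n j)).neg_mem h1.1))
    rw [h2, hg _ le_rfl] at h4
    rw [← h4, neg_eq_zero] at h2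
    exact h2
  rw [linearIndependent_iff'] at hf
  have := hf s (fun i => if n i = n j then c i else 0) (by simpa [ite_smul] using h3) j hj.1
  simp at this
  exact hj.2 this

theorem span_eq_top_of_lifts
    (hc : ∀ g h, t g * t h - t h * t g ∈ filt K w t (w g + w h))
    (hgen : ∀ y : Y, ∃ N, y ∈ filt K w t N) {ι : Type*} {y : ι → Y}
    {f : ι → MvPolynomial G K}
    {n : ι → ℕ} (hl : ∀ i, Lifts w t (n i) (y i) (f i))
    (hf : ∀ N, hom K w N ≤ Submodule.span K (f '' {i | n i = N})) :
    Submodule.span K (Set.range y) = ⊤ := by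
  rw [eq_top_iff]
  have key : ∀ N, filt K w t N ≤ Submodule.span K (Set.range y) := by
    intro N
    induction N with
    | zero => simp [filt]
    | succ N ih =>
      have hfl : ∀ g ∈ Submodule.span K (f '' {i | n i = N}),
          ordMap K t g ∈ Submodule.span K (Set.range y) := by
        intro g hg
        induction hg using Submodule.span_induction with
        | zero => simp
        | add a b _ _ ha hb => rw [map_add]; exact add_mem ha hb
        | smul a b _ hb => rw [map_smul]; exact Submodule.smul_mem _ _ hb
        | mem x hx =>
          obtain ⟨i, rfl, rfl⟩ := hx
          have := sub_mem (Submodule.subset_span (Set.mem_range_self i)) (ih (hl i).2)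
          simpa using this
      rw [filt, Submodule.span_le]
      rintro _ ⟨l, hlN, rfl⟩
      rcases (Nat.lt_succ_iff.1 hlN).eq_or_lt with h | h
      · have h1 := lifts_prod (K := K) hc l
        rw [h] at h1
        simpa using add_mem (ih h1.2) (hfl _ (hf N h1.1))
      · exact ih (prod_mem_filt h)
  intro x _
  obtain ⟨N, hN⟩ := hgen x
  exact key N hN

end Filtered

/-- Exponent vectors of length `n`. -/
def Ex : ℕ → Type
  | 0 => Unit
  | n + 1 => Ex n × ℕ

/-- The ordered monomial in `h 0, …, h (n - 1)` with a given exponent vector. -/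
def emon {M : Type*} [Monoid M] (h : ℕ → M) : ∀ n, Ex n → M
  | 0, _ => 1
  | n + 1, a => emon h n a.1 * h n ^ a.2

/-- The weight of an exponent vector. -/
def ewt (d : ℕ → ℕ) : ∀ n, Ex n → ℕ
  | 0, _ => 0
  | n + 1, a => ewt d n a.1 + a.2 * d n

section Relative

variable {K R : Type*} [Field K] [CommRing R] [Algebra K R]

/-- The products of monomials in `h 0, …, h (n - 1)` with the elements `m β` form a homogeneous
basis of `R` modulo the ideal `I`. -/
structure RelBasis (𝒢 : ℕ → Submodule K R) (h : ℕ → R) (d : ℕ → ℕ) (I : Ideal R) (n : ℕ)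
    {N : Type} (m : N → R) (wt : N → ℕ) : Prop where
  mem : ∀ β, m β ∈ 𝒢 (wt β)
  indep : ∀ u : Ex n × N →₀ K,
    Finsupp.linearCombination K (fun q : Ex n × N => emon h n q.1 * m q.2) u ∈ I → u = 0
  span : ∀ W, 𝒢 W ≤ Submodule.span K ((fun q : Ex n × N => emon h n q.1 * m q.2) ''
    {q | ewt d n q.1 + wt q.2 = W}) ⊔ I.restrictScalars K

variable {𝒢 : ℕ → Submodule K R} {h : ℕ → R} {d : ℕ → ℕ} {I Ix Iy : Ideal R} {n : ℕ}
  {N N' : Type} {m : N → R} {wt : N → ℕ} {m' : N' → R} {wt' : N' → ℕ}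

lemma emon_mem (h1 : (1 : R) ∈ 𝒢 0)
    (hmul : ∀ {i j a b}, a ∈ 𝒢 i → b ∈ 𝒢 j → a * b ∈ 𝒢 (i + j))
    (hh : ∀ k, k < n → h k ∈ 𝒢 (d k)) (α : Ex n) : emon h n α ∈ 𝒢 (ewt d n α) := by
  induction n with
  | zero => exact h1
  | succ n ih =>
    refine hmul (ih (fun k hk => hh k (by omega)) _) ?_
    have : ∀ k, h n ^ k ∈ 𝒢 (k * d n) := by
      intro k
      induction k with
      | zero => simpa using h1
      | succ k ihk => rw [pow_succ, add_mul, one_mul]; exact hmul ihk (hh n (by omega))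
    exact this _

lemma injective_inl {E N N' : Type*} (k : ℕ) :
    Function.Injective (fun q : E × N => ((q.1, k), (Sum.inl q.2 : N ⊕ N'))) := by
  rintro ⟨a, b⟩ ⟨c, d⟩ hab
  simpa using hab

lemma injective_inr {E N N' : Type*} (k : ℕ) :
    Function.Injective (fun q : E × N' => ((q.1, k), (Sum.inr q.2 : N ⊕ N'))) := by
  rintro ⟨a, b⟩ ⟨c, d⟩ hab
  simpa using hab

lemma linearCombination_eq_sum {E : Type*} (e : E → R) (z x : R) (m : N → R) (m' : N' → R)
    (l : (E × ℕ) × (N ⊕ N') →₀ K) :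
    ∃ B₀, ∀ B, B₀ ≤ B → Finsupp.linearCombination K
      (fun q : (E × ℕ) × (N ⊕ N') => e q.1.1 * z ^ q.1.2 *
        Sum.elim m (fun β => x * m' β) q.2) l =
      ∑ k ∈ Finset.range B, z ^ k *
        (Finsupp.linearCombination K (fun q : E × N => e q.1 * m q.2)
          (l.comapDomain _ (injective_inl k).injOn)
        + x * Finsupp.linearCombination K (fun q : E × N' => e q.1 * m' q.2)
          (l.comapDomain _ (injective_inr k).injOn)) := by
  classical
  induction l using Finsupp.induction_linear with
  | zero => exact ⟨0, fun B _ => by simp⟩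
  | add f g hf hg =>
    obtain ⟨B₁, h₁⟩ := hf
    obtain ⟨B₂, h₂⟩ := hg
    refine ⟨max B₁ B₂, fun B hB => ?_⟩
    rw [map_add, h₁ B (le_trans (le_max_left _ _) hB), h₂ B (le_trans (le_max_right _ _) hB),
      ← Finset.sum_add_distrib]
    refine Finset.sum_congr rfl fun k _ => ?_
    rw [Finsupp.comapDomain_add_of_injective (injective_inl k),
      Finsupp.comapDomain_add_of_injective (injective_inr k), map_add, map_add]
    ring
  | single a c =>
    obtain ⟨⟨α, k₀⟩, s⟩ := a
    refine ⟨k₀ + 1, fun B hB => ?_⟩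
    rw [Finset.sum_eq_single_of_mem k₀ (Finset.mem_range.2 (by omega))]
    · rcases s with β | β
      · have e1 : Finsupp.comapDomain (fun q : E × N => ((q.1, k₀), (Sum.inl q.2 : N ⊕ N')))
            (Finsupp.single ((α, k₀), Sum.inl β) c) (injective_inl k₀).injOn =
            Finsupp.single (α, β) c := by
          ext ⟨α', β'⟩
          simp [Finsupp.comapDomain_apply, Finsupp.single_apply]
        have e2 : Finsupp.comapDomain (fun q : E × N' => ((q.1, k₀), (Sum.inr q.2 : N ⊕ N')))
            (Finsupp.single ((α, k₀), Sum.inl β) c) (injective_inr k₀).injOn = 0 := by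
          ext ⟨α', β'⟩
          simp
        rw [e1, e2]
        simp only [Finsupp.linearCombination_single, map_zero, mul_zero, add_zero, Sum.elim_inl,
          Algebra.smul_def]
        ring
      · have e1 : Finsupp.comapDomain (fun q : E × N => ((q.1, k₀), (Sum.inl q.2 : N ⊕ N')))
            (Finsupp.single ((α, k₀), Sum.inr β) c) (injective_inl k₀).injOn = 0 := by
          ext ⟨α', β'⟩
          simp
        have e2 : Finsupp.comapDomain (fun q : E × N' => ((q.1, k₀), (Sum.inr q.2 : N ⊕ N')))
            (Finsupp.single ((α, k₀), Sum.inr β) c) (injective_inr k₀).injOn =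
            Finsupp.single (α, β) c := by
          ext ⟨α', β'⟩
          simp [Finsupp.comapDomain_apply, Finsupp.single_apply]
        rw [e1, e2]
        simp only [Finsupp.linearCombination_single, map_zero, zero_add, Sum.elim_inr,
          Algebra.smul_def]
        ring
    · intro k _ hk
      have e1 : Finsupp.comapDomain (fun q : E × N => ((q.1, k), (Sum.inl q.2 : N ⊕ N')))
          (Finsupp.single ((α, k₀), s) c) (injective_inl k).injOn = 0 := by
        ext ⟨α', β'⟩
        simp [Finsupp.comapDomain_apply, Ne.symm hk]
      have e2 : Finsupp.comapDomain (fun q : E × N' => ((q.1, k), (Sum.inr q.2 : N ⊕ N')))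
          (Finsupp.single ((α, k₀), s) c) (injective_inr k).injOn = 0 := by
        ext ⟨α', β'⟩
        simp [Finsupp.comapDomain_apply, Ne.symm hk]
      rw [e1, e2]
      simp

lemma RelBasis.step (h1 : (1 : R) ∈ 𝒢 0)
    (hmul : ∀ {i j a b}, a ∈ 𝒢 i → b ∈ 𝒢 j → a * b ∈ 𝒢 (i + j))
    (hh : ∀ k, k < n → h k ∈ 𝒢 (d k))
    (hIx : I ≤ Ix) (hIy : I ≤ Iy) {x y : R} {dx dy : ℕ} (hx : x ∈ 𝒢 dx)
    (hd : d n = dx + dy) (hpos : 0 < dx + dy) (hz : h n - x * y ∈ I)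
    (hxI : x ∈ Ix) (hyI : y ∈ Iy)
    (hxr : ∀ r, x * r ∈ I → r ∈ I) (hyr : ∀ r, y * r ∈ I → r ∈ I)
    (hxk : ∀ W, ∀ r ∈ 𝒢 W, r ∈ Ix → ∃ q, r - x * q ∈ I ∧ (q = 0 ∨ ∃ W', W' + dx = W ∧ q ∈ 𝒢 W'))
    (hyk : ∀ W, ∀ r ∈ 𝒢 W, r ∈ Iy → ∃ q, r - y * q ∈ I ∧ (q = 0 ∨ ∃ W', W' + dy = W ∧ q ∈ 𝒢 W'))
    (Bx : RelBasis 𝒢 h d Ix n m wt) (By : RelBasis 𝒢 h d Iy n m' wt') :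
    RelBasis 𝒢 h d I (n + 1) (Sum.elim m (fun β => x * m' β))
      (Sum.elim wt (fun β => dx + wt' β)) where
  mem := by
    rintro (β | β)
    · exact Bx.mem β
    · exact hmul hx (By.mem β)
  indep := by
    have key : ∀ (B : ℕ) (u : ℕ → (Ex n × N →₀ K)) (v : ℕ → (Ex n × N' →₀ K)),
        ∑ k ∈ Finset.range B, h n ^ k *
          (Finsupp.linearCombination K (fun q : Ex n × N => emon h n q.1 * m q.2) (u k)
          + x * Finsupp.linearCombination K (fun q : Ex n × N' => emon h n q.1 * m' q.2) (v k))
          ∈ I → ∀ k < B, u k = 0 ∧ v k = 0 := by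
      intro B
      induction B with
      | zero => intro u v _ k hk; omega
      | succ B ih =>
        intro u v hs
        rw [Finset.sum_range_succ'] at hs
        set S := ∑ k ∈ Finset.range B, h n ^ k *
          (Finsupp.linearCombination K (fun q : Ex n × N => emon h n q.1 * m q.2) (u (k + 1))
          + x * Finsupp.linearCombination K (fun q : Ex n × N' => emon h n q.1 * m' q.2)
            (v (k + 1))) with hS
        have e : ∑ k ∈ Finset.range B, h n ^ (k + 1) *
          (Finsupp.linearCombination K (fun q : Ex n × N => emon h n q.1 * m q.2) (u (k + 1))
          + x * Finsupp.linearCombination K (fun q : Ex n × N' => emon h n q.1 * m' q.2)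
            (v (k + 1))) = h n * S := by
          rw [hS, Finset.mul_sum]
          exact Finset.sum_congr rfl fun k _ => by ring
        rw [e, pow_zero, one_mul] at hs
        set u0 := Finsupp.linearCombination K (fun q : Ex n × N => emon h n q.1 * m q.2) (u 0)
        set v0 := Finsupp.linearCombination K (fun q : Ex n × N' => emon h n q.1 * m' q.2) (v 0)
        have hs2 : u0 + x * (v0 + y * S) ∈ I := by
          have := I.sub_mem hs (I.mul_mem_right S hz)
          convert this using 1; ring
        have hu : u 0 = 0 := Bx.indep _ (by
          have := Ix.sub_mem (hIx hs2) (Ix.mul_mem_right (v0 + y * S) hxI)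
          simpa using this)
        have hu0 : u0 = 0 := by simp [u0, hu]
        rw [hu0, zero_add] at hs2
        have hs3 := hxr _ hs2
        have hv : v 0 = 0 := By.indep _ (by
          have := Iy.sub_mem (hIy hs3) (Iy.mul_mem_right S hyI)
          simpa using this)
        have hv0 : v0 = 0 := by simp [v0, hv]
        rw [hv0, zero_add] at hs3
        have hs4 := ih (fun k => u (k + 1)) (fun k => v (k + 1)) (hyr _ hs3)
        intro k hk
        cases k with
        | zero => exact ⟨hu, hv⟩
        | succ k => exact hs4 k (by omega)
    intro l hl
    obtain ⟨B₀, hB⟩ := linearCombination_eq_sum (emon h n) (h n) x m m' l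
    ext ⟨⟨α, k⟩, s⟩
    have hlc := hB (max B₀ (k + 1)) (le_max_left _ _)
    have hl2 : Finsupp.linearCombination K
      (fun q : (Ex n × ℕ) × (N ⊕ N') => emon h n q.1.1 * h n ^ q.1.2 *
        Sum.elim m (fun β => x * m' β) q.2) l ∈ I := hl
    rw [hlc] at hl2
    obtain ⟨h3, h4⟩ := key _ _ _ hl2 k (lt_of_lt_of_le (Nat.lt_succ_self k) (le_max_right _ _))
    rcases s with β | β
    · exact DFunLike.congr_fun h3 (α, β)
    · exact DFunLike.congr_fun h4 (α, β)
  span := by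
    intro W
    induction W using Nat.strong_induction_on with
    | _ W ih =>
    set F : Ex (n + 1) × (N ⊕ N') → R := fun q => emon h (n + 1) q.1 *
      Sum.elim m (fun β => x * m' β) q.2 with hF
    set T : ℕ → Submodule K R := fun W => Submodule.span K (F ''
      {q | ewt d (n + 1) q.1 + Sum.elim wt (fun β => dx + wt' β) q.2 = W}) ⊔ I.restrictScalars K
      with hT
    have hIT : ∀ {W r}, r ∈ I → r ∈ T W := fun hr => Submodule.mem_sup_right hr
    have hzT : ∀ {W r}, r ∈ T W → h n * r ∈ T (W + d n) := by
      intro W r hr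
      obtain ⟨s, hs, i, hi, rfl⟩ := Submodule.mem_sup.1 hr
      rw [mul_add]
      refine add_mem ?_ (hIT (I.mul_mem_left _ hi))
      refine Submodule.mem_sup_left ?_
      clear hr
      induction hs using Submodule.span_induction with
      | zero => simp
      | add a b ha hb h1 h2 =>
        rw [mul_add]
        exact add_mem h1 h2
      | smul a b hb h1 =>
        rw [mul_smul_comm]
        exact Submodule.smul_mem _ _ h1
      | mem b hb =>
        obtain ⟨⟨⟨α, k⟩, s⟩, hq, rfl⟩ := hb
        refine Submodule.subset_span ⟨((α, k + 1), s), ?_, ?_⟩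
        · simp only [Set.mem_ofPred_eq, ewt] at hq ⊢
          rw [← hq]; ring
        · simp only [hF, emon]; ring
    have hUT : ∀ {W s}, s ∈ Submodule.span K ((fun q : Ex n × N => emon h n q.1 * m q.2) ''
        {q | ewt d n q.1 + wt q.2 = W}) → s ∈ T W ∧ s ∈ 𝒢 W := by
      intro W s hs
      constructor
      · refine Submodule.mem_sup_left (Submodule.span_mono ?_ hs)
        rintro _ ⟨⟨α, β⟩, hq, rfl⟩
        refine ⟨((α, 0), Sum.inl β), ?_, ?_⟩
        · simpa [ewt] using hq
        · simp [hF, emon]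
      · refine Submodule.span_le.2 ?_ hs
        rintro _ ⟨⟨α, β⟩, hq, rfl⟩
        have hq' : ewt d n α + wt β = W := hq
        rw [← hq']
        exact hmul (emon_mem h1 hmul hh α) (Bx.mem β)
    have hVT : ∀ {W s}, s ∈ Submodule.span K ((fun q : Ex n × N' => emon h n q.1 * m' q.2) ''
        {q | ewt d n q.1 + wt' q.2 = W}) → x * s ∈ T (W + dx) ∧ s ∈ 𝒢 W := by
      intro W s hs
      constructor
      · refine Submodule.mem_sup_left ?_
        have : x * s ∈ (Submodule.span K ((fun q : Ex n × N' => emon h n q.1 * m' q.2) ''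
          {q | ewt d n q.1 + wt' q.2 = W})).map (LinearMap.mulLeft K x) :=
          ⟨s, hs, rfl⟩
        rw [Submodule.map_span] at this
        refine Submodule.span_mono ?_ this
        rintro _ ⟨_, ⟨⟨α, β⟩, hq, rfl⟩, rfl⟩
        refine ⟨((α, 0), Sum.inr β), ?_, ?_⟩
        · simp only [Set.mem_ofPred_eq, ewt, Sum.elim_inr] at hq ⊢
          omega
        · simp [hF, emon]; ring
      · refine Submodule.span_le.2 ?_ hs
        rintro _ ⟨⟨α, β⟩, hq, rfl⟩
        have hq' : ewt d n α + wt' β = W := hq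
        rw [← hq']
        exact hmul (emon_mem h1 hmul hh α) (By.mem β)
    intro r hr
    change r ∈ T W
    obtain ⟨s, hs, i, hi, rfl⟩ := Submodule.mem_sup.1 (Bx.span W hr)
    obtain ⟨hsT, hsG⟩ := hUT hs
    have hiG : i ∈ 𝒢 W := by simpa using sub_mem hr hsG
    refine add_mem hsT ?_
    obtain ⟨q, hq, hq'⟩ := hxk W i hiG hi
    suffices hxq : x * q ∈ T W by simpa using add_mem (hIT hq) hxq
    rcases hq' with rfl | ⟨W', hW', hqG⟩
    · simp
    obtain ⟨s', hs', j, hj, rfl⟩ := Submodule.mem_sup.1 (By.span W' hqG)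
    obtain ⟨hsT', hsG'⟩ := hVT hs'
    have hjG : j ∈ 𝒢 W' := by simpa using sub_mem hqG hsG'
    rw [mul_add]
    refine add_mem (hW' ▸ hsT') ?_
    obtain ⟨q', hq', hq''⟩ := hyk W' j hjG hj
    suffices hxq : x * (y * q') ∈ T W by
      have := add_mem (hIT (W := W) (I.mul_mem_left x hq')) hxq
      convert this using 1; ring
    rcases hq'' with rfl | ⟨W'', hW'', hqG'⟩
    · simp
    have h5 := hzT (ih W'' (by omega) hqG')
    have h6 : W'' + d n = W := by omega
    rw [h6] at h5
    have := sub_mem h5 (hIT (W := W) (I.mul_mem_right q' hz))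
    convert this using 1; ring

end Relative

section VariableIdeals

variable {K σ : Type} [Field K]

/-- The ideal generated by a set of variables. -/
noncomputable abbrev varIdeal (K : Type) {σ : Type} [Field K] (Z : Set σ) :
    Ideal (MvPolynomial σ K) :=
  Ideal.span (MvPolynomial.X '' Z)

lemma mem_varIdeal_of_X_mul {Z : Set σ} {g : σ} (hg : g ∉ Z) {r : MvPolynomial σ K}
    (h : MvPolynomial.X g * r ∈ varIdeal K Z) : r ∈ varIdeal K Z := by
  classical
  rw [MvPolynomial.mem_ideal_span_X_image] at h ⊢
  intro e he
  obtain ⟨i, hi, hi'⟩ := h (Finsupp.single g 1 + e) (by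
    rw [MvPolynomial.mem_support_iff, MvPolynomial.coeff_X_mul]
    exact MvPolynomial.mem_support_iff.1 he)
  refine ⟨i, hi, ?_⟩
  have : g ≠ i := fun h => hg (h ▸ hi)
  simpa [Finsupp.single_apply, this] using hi'

lemma exists_sub_X_mul_mem {w : σ → ℕ} {Z : Set σ} {g : σ} {W : ℕ} {r : MvPolynomial σ K}
    (hr : r ∈ hom K w W) (hrI : r ∈ varIdeal K (insert g Z)) :
    ∃ q, r - MvPolynomial.X g * q ∈ varIdeal K Z ∧
      (q = 0 ∨ ∃ W', W' + w g = W ∧ q ∈ hom K w W') := by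
  classical
  rw [MvPolynomial.mem_ideal_span_X_image] at hrI
  have key : ∀ e : σ →₀ ℕ, e ∈ r.support → ∃ q : MvPolynomial σ K,
      MvPolynomial.monomial e (r.coeff e) - MvPolynomial.X g * q ∈ varIdeal K Z ∧
      q ∈ hom K w (W - w g) ∧ (q = 0 ∨ w g ≤ W) := by
    intro e he
    have hw : Finsupp.weight w e = W := hr (MvPolynomial.mem_support_iff.1 he)
    by_cases hZ : ∃ i ∈ Z, e i ≠ 0
    · refine ⟨0, ?_, zero_mem _, Or.inl rfl⟩
      rw [mul_zero, sub_zero, MvPolynomial.mem_ideal_span_X_image]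
      intro e' he'
      have := MvPolynomial.support_monomial_subset he'
      rw [Finset.mem_singleton] at this
      exact this ▸ hZ
    · obtain ⟨i, hi, hi'⟩ := hrI e he
      have hig : i = g := by
        rcases hi with h | h
        · exact h
        · exact absurd ⟨i, h, hi'⟩ hZ
      subst hig
      have he2 : Finsupp.single i 1 + (e - Finsupp.single i 1) = e := by
        apply add_tsub_cancel_of_le
        rw [Finsupp.single_le_iff]; omega
      have hw2 : w i + Finsupp.weight w (e - Finsupp.single i 1) = W := by
        rw [← hw]
        conv_rhs => rw [← he2, map_add]
        simp [Finsupp.weight_single]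
      refine ⟨MvPolynomial.monomial (e - Finsupp.single i 1) (r.coeff e), ?_, ?_, Or.inr (by omega)⟩
      · have : MvPolynomial.X i * MvPolynomial.monomial (e - Finsupp.single i 1) (r.coeff e) =
            MvPolynomial.monomial e (r.coeff e) := by
          rw [MvPolynomial.X, MvPolynomial.monomial_mul, he2, one_mul]
        rw [this, sub_self]
        exact zero_mem _
      · exact MvPolynomial.isWeightedHomogeneous_monomial _ _ _ (by omega)
  choose! q h1 h2 h3 using key
  refine ⟨∑ e ∈ r.support, q e, ?_, ?_⟩
  · have := Ideal.sum_mem _ h1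
    rwa [Finset.sum_sub_distrib, ← Finset.mul_sum, ← MvPolynomial.as_sum r] at this
  · by_cases hW : w g ≤ W
    · exact Or.inr ⟨W - w g, by omega, Submodule.sum_mem _ h2⟩
    · exact Or.inl (Finset.sum_eq_zero fun e he => (h3 e he).resolve_right hW)

lemma relBasis_zero (w : σ → ℕ) (h : ℕ → MvPolynomial σ K) (d : ℕ → ℕ) (Z : Set σ) :
    RelBasis (hom K w) h d (varIdeal K Z) 0
      (fun e : {e : σ →₀ ℕ // ∀ g ∈ Z, e g = 0} => MvPolynomial.monomial e.1 (1 : K))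
      (fun e => Finsupp.weight w e.1) where
  mem e := MvPolynomial.isWeightedHomogeneous_monomial _ _ _ rfl
  indep u hu := by
    classical
    ext ⟨α, e⟩
    by_contra hne
    rw [MvPolynomial.mem_ideal_span_X_image] at hu
    obtain ⟨i, hi, hi'⟩ := hu e.1 (by
      rw [MvPolynomial.mem_support_iff, Finsupp.linearCombination_apply, Finsupp.sum,
        MvPolynomial.coeff_sum, Finset.sum_eq_single (α, e)]
      · simpa [emon] using hne
      · rintro ⟨α', e'⟩ _ hb
        have : e'.1 ≠ e.1 := fun h => hb (by
          rw [Prod.mk.injEq]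
          exact ⟨rfl, Subtype.ext h⟩)
        simp [emon, MvPolynomial.coeff_monomial, this]
      · intro h
        simp [Finsupp.notMem_support_iff.1 h])
    exact hi' (e.2 i hi)
  span W f hf := by
    classical
    rw [MvPolynomial.as_sum f]
    refine Submodule.sum_mem _ fun e he => ?_
    by_cases hZ : ∀ g ∈ Z, e g = 0
    · refine Submodule.mem_sup_left ?_
      have : MvPolynomial.monomial e (f.coeff e) = f.coeff e • MvPolynomial.monomial e (1 : K) := by
        simp [MvPolynomial.smul_monomial]
      rw [this]
      refine Submodule.smul_mem _ _ (Submodule.subset_span ⟨((), ⟨e, hZ⟩), ?_, ?_⟩)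
      · have : Finsupp.weight w e = W := hf (MvPolynomial.mem_support_iff.1 he)
        simpa [ewt] using this
      · simp [emon]
    · refine Submodule.mem_sup_right ?_
      rw [Submodule.restrictScalars_mem, MvPolynomial.mem_ideal_span_X_image]
      intro e' he'
      have := MvPolynomial.support_monomial_subset he'
      rw [Finset.mem_singleton] at this
      push Not at hZ
      exact this ▸ hZ

end VariableIdeals

section Symbols

variable {K : Type} [Field K] {p : ℕ}

/-- The weight of a generator. -/
def gw (p : ℕ) (g : YGen p) : ℕ := g.2.2 + 1

/-- The commutative counterpart of `tY`. -/
noncomputable def xR (K : Type) [Field K] (p : ℕ) (i j : Fin 2) (r : ℕ) :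
    MvPolynomial (YGen p) K :=
  if h0 : r = 0 then (if i = j then 1 else 0)
  else if h : r ≤ p then MvPolynomial.X (i, j, (⟨r - 1, by omega⟩ : Fin p)) else 0

lemma xR_zero (i j : Fin 2) : xR K p i j 0 = if i = j then 1 else 0 := by simp [xR]

lemma xR_of_lt {i j : Fin 2} {r : ℕ} (h : p < r) : xR K p i j r = 0 := by
  simp [xR, show r ≠ 0 by omega, show ¬ r ≤ p by omega]

lemma xR_succ (i j : Fin 2) (k : Fin p) : xR K p i j (k + 1) = MvPolynomial.X (i, j, k) := by
  simp [xR, show (k : ℕ) + 1 ≤ p from k.2]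

lemma xR_eq_X {i j : Fin 2} {r : ℕ} (h : 1 ≤ r) (h' : r ≤ p) :
    xR K p i j r = MvPolynomial.X (i, j, (⟨r - 1, by omega⟩ : Fin p)) := by
  simp [xR, show r ≠ 0 by omega, h']

lemma xR_mem (i j : Fin 2) (r : ℕ) : xR K p i j r ∈ hom K (gw p) r := by
  rcases Nat.eq_zero_or_pos r with rfl | hr
  · rw [xR_zero]
    split_ifs
    · exact MvPolynomial.isWeightedHomogeneous_one K _
    · exact zero_mem _
  · by_cases h : r ≤ p
    · rw [xR_eq_X hr h]
      have := MvPolynomial.isWeightedHomogeneous_X K (gw p) (i, j, (⟨r - 1, by omega⟩ : Fin p))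
      rwa [show gw p (i, j, (⟨r - 1, by omega⟩ : Fin p)) = r by simp [gw]; omega] at this
    · rw [xR_of_lt (by omega)]
      exact zero_mem _

/-- The off-diagonal part of the symbol of the quantum determinant. -/
noncomputable def offdiag (K : Type) [Field K] (p k : ℕ) : MvPolynomial (YGen p) K :=
  ∑ a ∈ Finset.HasAntidiagonal.antidiagonal k, xR K p 1 0 a.1 * xR K p 0 1 a.2

/-- The symbol of a quantum determinant coefficient. -/
noncomputable def delta (K : Type) [Field K] (p k : ℕ) : MvPolynomial (YGen p) K :=
  ∑ a ∈ Finset.HasAntidiagonal.antidiagonal k,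
    (xR K p 0 0 a.1 * xR K p 1 1 a.2 - xR K p 1 0 a.1 * xR K p 0 1 a.2)

lemma offdiag_mem (k : ℕ) : offdiag K p k ∈ hom K (gw p) k :=
  Submodule.sum_mem _ fun a ha => by
    rw [← Finset.HasAntidiagonal.mem_antidiagonal.1 ha]
    exact MvPolynomial.IsWeightedHomogeneous.mul (xR_mem _ _ _) (xR_mem _ _ _)

lemma delta_mem (k : ℕ) : delta K p k ∈ hom K (gw p) k :=
  Submodule.sum_mem _ fun a ha => by
    rw [← Finset.HasAntidiagonal.mem_antidiagonal.1 ha]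
    exact sub_mem (MvPolynomial.IsWeightedHomogeneous.mul (xR_mem _ _ _) (xR_mem _ _ _))
      (MvPolynomial.IsWeightedHomogeneous.mul (xR_mem _ _ _) (xR_mem _ _ _))

/-- The generators of `Γ` in a convenient order, in terms of the quantum determinant coefficients
`D` and the generators `T`. -/
def gseq {M : Type*} (p : ℕ) (D T : ℕ → M) (l : ℕ) : M :=
  if l < p then D (p + 1 + l) else if l < 2 * p then D (l - p + 1) else T (l - 2 * p + 1)

lemma gseq_mem (l : ℕ) :
    gseq p (delta K p) (xR K p 1 1) l ∈ hom K (gw p) (gseq p id id l) := by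
  unfold gseq
  split_ifs
  · exact delta_mem _
  · exact delta_mem _
  · exact xR_mem _ _ _

/-- The automorphism adding `s` times the off-diagonal part to the generators `t₁₁`. -/
noncomputable def twist (K : Type) [Field K] (p : ℕ) (s : K) :
    MvPolynomial (YGen p) K →ₐ[K] MvPolynomial (YGen p) K :=
  MvPolynomial.aeval fun g => MvPolynomial.X g +
    if g.1 = 0 ∧ g.2.1 = 0 then s • offdiag K p (gw p g) else 0

lemma twist_xR (s : K) (i j : Fin 2) (r : ℕ) :
    twist K p s (xR K p i j r) =
      xR K p i j r + if i = 0 ∧ j = 0 ∧ r ≤ p then s • offdiag K p r else 0 := by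
  rcases Nat.eq_zero_or_pos r with rfl | hr
  · have : offdiag K p 0 = 0 := by simp [offdiag, xR_zero]
    rw [xR_zero, this]
    split_ifs <;> simp
  · by_cases h : r ≤ p
    · rw [xR_eq_X hr h, twist, MvPolynomial.aeval_X]
      simp [h, gw, show r - 1 + 1 = r by omega]
    · rw [xR_of_lt (by omega)]
      simp [h]

lemma twist_offdiag (s : K) (k : ℕ) : twist K p s (offdiag K p k) = offdiag K p k := by
  simp [offdiag, map_sum, twist_xR]

lemma twist_twist (s : K) (f : MvPolynomial (YGen p) K) : twist K p (-s) (twist K p s f) = f := by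
  have : (twist K p (-s)).comp (twist K p s) = AlgHom.id K _ := by
    ext1 ⟨i, j, k⟩
    rw [AlgHom.comp_apply, AlgHom.id_apply, ← xR_succ, twist_xR]
    split_ifs with h
    · rw [map_add, map_smul, twist_offdiag, twist_xR, if_pos h]
      simp
    · rw [map_add, twist_xR, if_neg h]
      simp
  exact DFunLike.congr_fun this f

lemma twist_mem (s : K) {N : ℕ} {f : MvPolynomial (YGen p) K} (hf : f ∈ hom K (gw p) N) :
    twist K p s f ∈ hom K (gw p) N := by
  rw [hom_eq_span] at hf
  induction hf using Submodule.span_induction with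
  | zero => simp
  | add a b _ _ h1 h2 => rw [map_add]; exact add_mem h1 h2
  | smul a b _ h1 => rw [map_smul]; exact Submodule.smul_mem _ _ h1
  | mem f hf =>
    obtain ⟨l, rfl, rfl⟩ := hf
    induction l with
    | nil => simpa using MvPolynomial.isWeightedHomogeneous_one K (gw p)
    | cons g l ih =>
      rw [List.map_cons, List.map_cons, List.sum_cons, List.prod_cons, map_mul]
      refine MvPolynomial.IsWeightedHomogeneous.mul ?_ ih
      rw [twist, MvPolynomial.aeval_X]
      refine MvPolynomial.IsWeightedHomogeneous.add (MvPolynomial.isWeightedHomogeneous_X K _ _) ?_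
      split_ifs
      · exact Submodule.smul_mem _ _ (offdiag_mem _)
      · exact MvPolynomial.isWeightedHomogeneous_zero K _ _

/-- The set of variables vanishing on the stratum indexed by `n`, `a`, `b`. -/
def zset (p n a b : ℕ) : Set (YGen p) :=
  {g | (g.1 = 1 ∧ g.2.1 = 1 ∧ n < gw p g + 2 * p) ∨ (g.1 = 0 ∧ g.2.1 = 0 ∧ n < gw p g + p) ∨
    (g.1 = 0 ∧ g.2.1 = 1 ∧ p < gw p g + a) ∨ (g.1 = 1 ∧ g.2.1 = 0 ∧ p < gw p g + b)}

lemma xR_mem_varIdeal {n a b : ℕ} {i j : Fin 2} {r : ℕ} (hr : 1 ≤ r)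
    (h : (i = 1 ∧ j = 1 ∧ n < r + 2 * p) ∨ (i = 0 ∧ j = 0 ∧ n < r + p) ∨
    (i = 0 ∧ j = 1 ∧ p < r + a) ∨ (i = 1 ∧ j = 0 ∧ p < r + b)) :
    xR K p i j r ∈ varIdeal K (zset p n a b) := by
  by_cases hp : r ≤ p
  · rw [xR_eq_X hr hp]
    refine Ideal.subset_span ⟨_, ?_, rfl⟩
    simpa [zset, gw, show r - 1 + 1 = r by omega] using h
  · rw [xR_of_lt (by omega)]
    exact zero_mem _

lemma twist_delta (k : ℕ) : twist K p 1 (delta K p k) =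
    ∑ a ∈ Finset.HasAntidiagonal.antidiagonal k, (twist K p 1 (xR K p 0 0 a.1)) * xR K p 1 1 a.2
      - offdiag K p k := by
  simp [delta, offdiag, map_sum, twist_xR]

lemma twist_delta_of_lt {n a b : ℕ} (h : a + b + (n + 1) = p) :
    twist K p 1 (delta K p (p + 1 + n)) - -xR K p 0 1 (p - a) * xR K p 1 0 (p - b) ∈
      varIdeal K (zset p (n + 1) a b) := by
  rw [twist_delta, offdiag, ← Finset.add_sum_erase (a := (p - b, p - a)) _
    (fun a => xR K p 1 0 a.1 * xR K p 0 1 a.2)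
    (Finset.HasAntidiagonal.mem_antidiagonal.2 (by simp only; omega))]
  have e : ∀ A B x y : MvPolynomial (YGen p) K, A - (x * y + B) - -y * x = A - B := by
    intros; ring
  rw [e]
  refine sub_mem (Ideal.sum_mem _ fun c hc => ?_) (Ideal.sum_mem _ fun c hc => ?_)
  · have hc := Finset.HasAntidiagonal.mem_antidiagonal.1 hc
    rcases Nat.eq_zero_or_pos c.2 with h0 | h0
    · rw [xR_of_lt (show p < c.1 by omega), map_zero, zero_mul]
      exact zero_mem _
    · exact Ideal.mul_mem_left _ _ (xR_mem_varIdeal h0 (Or.inl ⟨rfl, rfl, by omega⟩))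
  · obtain ⟨hne, hc⟩ := Finset.mem_erase.1 hc
    have hc := Finset.HasAntidiagonal.mem_antidiagonal.1 hc
    by_cases h1 : p - b < c.1
    · exact Ideal.mul_mem_right _ _ (xR_mem_varIdeal (by omega)
        (Or.inr (Or.inr (Or.inr ⟨rfl, rfl, by omega⟩))))
    · have h2 : p - a < c.2 := by
        by_contra h2
        exact hne (Prod.ext (by simp only; omega) (by simp only; omega))
      exact Ideal.mul_mem_left _ _ (xR_mem_varIdeal (by omega)
        (Or.inr (Or.inr (Or.inl ⟨rfl, rfl, by omega⟩))))

lemma twist_delta_of_le {n : ℕ} (h : p ≤ n) (h' : n < 2 * p) :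
    twist K p 1 (delta K p (n - p + 1)) - xR K p 0 0 (n - p + 1) ∈
      varIdeal K (zset p (n + 1) 0 0) := by
  rw [twist_delta, ← Finset.add_sum_erase (a := (n - p + 1, 0)) _ _
    (Finset.HasAntidiagonal.mem_antidiagonal.2 (by simp only)), xR_zero, if_pos rfl, mul_one,
    twist_xR,
    if_pos ⟨rfl, rfl, by simp only; omega⟩, one_smul]
  have e : ∀ x y z : MvPolynomial (YGen p) K, x + y + z - y - x = z := by intros; ring
  rw [e]
  refine Ideal.sum_mem _ fun c hc => ?_
  obtain ⟨hne, hc⟩ := Finset.mem_erase.1 hc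
  have hc := Finset.HasAntidiagonal.mem_antidiagonal.1 hc
  have h0 : 1 ≤ c.2 := by
    by_contra h0
    exact hne (Prod.ext (by simp only; omega) (by simp only; omega))
  exact Ideal.mul_mem_left _ _ (xR_mem_varIdeal h0 (Or.inl ⟨rfl, rfl, by omega⟩))

lemma zset_left {n a b : ℕ} (h : a + b + (n + 1) = p) :
    zset p n (a + 1) b = insert (0, 1, ⟨p - a - 1, by omega⟩) (zset p (n + 1) a b) := by
  ext ⟨i, j, k, hk⟩
  fin_cases i <;> fin_cases j <;> simp [zset, gw] <;> omega

lemma zset_right {n a b : ℕ} (h : a + b + (n + 1) = p) :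
    zset p n a (b + 1) = insert (1, 0, ⟨p - b - 1, by omega⟩) (zset p (n + 1) a b) := by
  ext ⟨i, j, k, hk⟩
  fin_cases i <;> fin_cases j <;> simp [zset, gw] <;> omega

lemma zset_mid {n : ℕ} (h : p ≤ n) (h' : n < 2 * p) :
    zset p n 0 0 = insert (0, 0, ⟨n - p, by omega⟩) (zset p (n + 1) 0 0) := by
  ext ⟨i, j, k, hk⟩
  fin_cases i <;> fin_cases j <;> simp [zset, gw] <;> omega

lemma zset_last {n : ℕ} (h : 2 * p ≤ n) (h' : n < 3 * p) :
    zset p n 0 0 = insert (1, 1, ⟨n - 2 * p, by omega⟩) (zset p (n + 1) 0 0) := by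
  ext ⟨i, j, k, hk⟩
  fin_cases i <;> fin_cases j <;> simp [zset, gw] <;> omega

lemma relBasis_top {σ : Type} (w : σ → ℕ) (h : ℕ → MvPolynomial σ K) (d : ℕ → ℕ) (n : ℕ) :
    RelBasis (hom K w) h d ⊤ n (N := Empty) Empty.elim Empty.elim where
  mem := nofun
  indep u _ := by
    ext ⟨_, e⟩
    exact e.elim
  span W f _ := Submodule.mem_sup_right trivial

lemma RelBasis.step_of_var {σ : Type} {w : σ → ℕ} {h : ℕ → MvPolynomial σ K} {d : ℕ → ℕ}
    {n : ℕ} {Z : Set σ} {g : σ} (hg : g ∉ Z) (hpos : 0 < w g) (hd : d n = w g)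
    (hh : ∀ k, h k ∈ hom K w (d k)) (hz : h n - MvPolynomial.X g ∈ varIdeal K Z)
    {N : Type} {m : N → MvPolynomial σ K} {wt : N → ℕ}
    (B : RelBasis (hom K w) h d (varIdeal K (insert g Z)) n m wt) :
    RelBasis (hom K w) h d (varIdeal K Z) (n + 1)
      (Sum.elim m (fun β : Empty => MvPolynomial.X g * β.elim))
      (Sum.elim wt (fun β => w g + β.elim)) :=
  RelBasis.step (y := 1) (dy := 0) (MvPolynomial.isWeightedHomogeneous_one K w)
    (fun ha hb => MvPolynomial.IsWeightedHomogeneous.mul ha hb) (fun k _ => hh k)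
    (Ideal.span_mono (Set.image_mono (Set.subset_insert _ _))) le_top
    (MvPolynomial.isWeightedHomogeneous_X K w g) hd hpos (by simpa using hz)
    (Ideal.subset_span ⟨g, Set.mem_insert _ _, rfl⟩) trivial
    (fun r hr => mem_varIdeal_of_X_mul hg hr) (fun r hr => by simpa using hr)
    (fun W r hr hrI => exists_sub_X_mul_mem hr hrI)
    (fun W r hr _ => ⟨r, by simp, Or.inr ⟨W, rfl, hr⟩⟩) B (relBasis_top w h d n)

lemma exists_relBasis_of_le (n : ℕ) : ∀ a b, a + b + n = p →
    ∃ (N : Type) (m : N → MvPolynomial (YGen p) K) (wt : N → ℕ),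
      RelBasis (hom K (gw p)) (fun l => twist K p 1 (gseq p (delta K p) (xR K p 1 1) l))
        (gseq p id id) (varIdeal K (zset p n a b)) n m wt ∧ ∃ o, m o = 1 := by
  induction n with
  | zero => exact fun a b _ => ⟨_, _, _, relBasis_zero _ _ _ _, ⟨0, by simp⟩, by simp⟩
  | succ n ih =>
    intro a b h
    obtain ⟨N, m, wt, B, o, ho⟩ := ih (a + 1) b (by omega)
    obtain ⟨N', m', wt', B', -⟩ := ih a (b + 1) (by omega)
    rw [zset_left h] at B
    rw [zset_right h] at B'
    have hx : xR K p 0 1 (p - a) = MvPolynomial.X (0, 1, ⟨p - a - 1, by omega⟩) :=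
      xR_eq_X (by omega) (by omega)
    have hy : xR K p 1 0 (p - b) = MvPolynomial.X (1, 0, ⟨p - b - 1, by omega⟩) :=
      xR_eq_X (by omega) (by omega)
    refine ⟨N ⊕ N', _, _, RelBasis.step (x := -xR K p 0 1 (p - a)) (y := xR K p 1 0 (p - b))
      (dx := p - a) (dy := p - b)
      (MvPolynomial.isWeightedHomogeneous_one K _)
      (fun ha hb => MvPolynomial.IsWeightedHomogeneous.mul ha hb)
      (fun k _ => twist_mem _ (gseq_mem k))
      (Ideal.span_mono (Set.image_mono (Set.subset_insert _ _)))
      (Ideal.span_mono (Set.image_mono (Set.subset_insert _ _))) (neg_mem (xR_mem _ _ _)) ?_ ?_ ?_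
      ?_ ?_ ?_ ?_ ?_ ?_ B B', Sum.inl o, ho⟩
    · simp [gseq, show n < p by omega]; omega
    · omega
    · simpa only [gseq, show n < p by omega, if_true] using twist_delta_of_lt h
    · rw [hx]
      exact neg_mem (Ideal.subset_span ⟨_, Set.mem_insert _ _, rfl⟩)
    · rw [hy]
      exact Ideal.subset_span ⟨_, Set.mem_insert _ _, rfl⟩
    · intro r hr
      rw [hx, neg_mul, neg_mem_iff] at hr
      refine mem_varIdeal_of_X_mul ?_ hr
      simp [zset, gw]; omega
    · intro r hr
      rw [hy] at hr
      refine mem_varIdeal_of_X_mul ?_ hr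
      simp [zset, gw]; omega
    · intro W r hr hrI
      obtain ⟨q, hq, hq'⟩ := exists_sub_X_mul_mem hr hrI
      refine ⟨-q, by rw [hx]; simpa using hq, ?_⟩
      rcases hq' with rfl | ⟨W', hW, hW'⟩
      · simp
      · refine Or.inr ⟨W', ?_, neg_mem hW'⟩
        simp [gw] at hW; omega
    · intro W r hr hrI
      obtain ⟨q, hq, hq'⟩ := exists_sub_X_mul_mem hr hrI
      refine ⟨q, by rwa [hy], hq'.imp_right ?_⟩
      rintro ⟨W', hW, hW'⟩
      refine ⟨W', ?_, hW'⟩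
      simp [gw] at hW; omega

lemma exists_relBasis_of_ge (n : ℕ) (hn : p ≤ n) (hn' : n ≤ 3 * p) :
    ∃ (N : Type) (m : N → MvPolynomial (YGen p) K) (wt : N → ℕ),
      RelBasis (hom K (gw p)) (fun l => twist K p 1 (gseq p (delta K p) (xR K p 1 1) l))
        (gseq p id id) (varIdeal K (zset p n 0 0)) n m wt ∧ ∃ o, m o = 1 := by
  induction n, hn using Nat.le_induction with
  | base => exact exists_relBasis_of_le p 0 0 (by omega)
  | succ n hn ih =>
    obtain ⟨N, m, wt, B, o, ho⟩ := ih (by omega)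
    by_cases h : n < 2 * p
    · rw [zset_mid hn h] at B
      refine ⟨N ⊕ Empty, _, _, B.step_of_var ?_ ?_ ?_ (fun k => twist_mem _ (gseq_mem k)) ?_,
        Sum.inl o, ho⟩
      · simp [zset, gw]; omega
      · simp [gw]
      · simp [gseq, gw, show ¬ n < p by omega, h]
      · have := twist_delta_of_le (K := K) hn h
        rw [xR_succ 0 0 ⟨n - p, by omega⟩] at this
        simpa only [gseq, show ¬ n < p by omega, h, if_true, if_false] using this
    · rw [zset_last (by omega) (by omega)] at B
      refine ⟨N ⊕ Empty, _, _, B.step_of_var ?_ ?_ ?_ (fun k => twist_mem _ (gseq_mem k)) ?_,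
        Sum.inl o, ho⟩
      · simp [zset, gw]; omega
      · simp [gw]
      · simp [gseq, gw, show ¬ n < p by omega, h]
      · simp only [gseq, show ¬ n < p by omega, h, if_false, twist_xR]
        rw [xR_succ 1 1 ⟨n - 2 * p, by omega⟩]
        simp

theorem exists_symbol_basis (K : Type) [Field K] (p : ℕ) :
    ∃ (N : Type) (m : N → MvPolynomial (YGen p) K) (wt : N → ℕ),
      (∀ β, m β ∈ hom K (gw p) (wt β)) ∧
      LinearIndependent K (fun q : Ex (3 * p) × N =>
        emon (gseq p (delta K p) (xR K p 1 1)) (3 * p) q.1 * m q.2) ∧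
      (∀ W, hom K (gw p) W ≤ Submodule.span K ((fun q : Ex (3 * p) × N =>
        emon (gseq p (delta K p) (xR K p 1 1)) (3 * p) q.1 * m q.2) ''
          {q | ewt (gseq p id id) (3 * p) q.1 + wt q.2 = W})) ∧ ∃ o, m o = 1 := by
  obtain ⟨N, m, wt, B, o, ho⟩ := exists_relBasis_of_ge (K := K) (p := p) (3 * p) (by omega) le_rfl
  have hZ : varIdeal K (zset p (3 * p) 0 0) = ⊥ := by
    have : zset p (3 * p) 0 0 = ∅ := by
      ext ⟨i, j, k, hk⟩
      simp [zset, gw]; omega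
    rw [varIdeal, this, Set.image_empty, Ideal.span_empty]
  rw [hZ] at B
  have hem : ∀ n α, twist K p (-1) (emon (fun l => twist K p 1
      (gseq p (delta K p) (xR K p 1 1) l)) n α) =
      emon (gseq p (delta K p) (xR K p 1 1)) n α := by
    intro n
    induction n with
    | zero => intro α; simp [emon]
    | succ n ih => intro α; simp only [emon, map_mul, ih, map_pow, twist_twist]
  have hF : (fun q : Ex (3 * p) × N =>
        emon (gseq p (delta K p) (xR K p 1 1)) (3 * p) q.1 * twist K p (-1) (m q.2)) =
      (twist K p (-1)).toLinearMap ∘ (fun q : Ex (3 * p) × N =>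
        emon (fun l => twist K p 1 (gseq p (delta K p) (xR K p 1 1) l)) (3 * p) q.1 * m q.2) := by
    funext q
    simp [hem]
  refine ⟨N, fun β => twist K p (-1) (m β), wt, fun β => twist_mem _ (B.mem β), ?_, ?_, o,
    by simp [ho]⟩
  · rw [hF]
    refine LinearIndependent.map' (linearIndependent_iff.2 fun u hu => B.indep u ?_) _ ?_
    · simpa using hu
    · refine LinearMap.ker_eq_bot_of_inverse (g := (twist K p 1).toLinearMap) ?_
      refine LinearMap.ext fun f => ?_
      simpa using twist_twist (-1 : K) f
  · intro W f hf
    have h1 : twist K p 1 f ∈ _ := B.span W (twist_mem 1 hf)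
    rw [Submodule.restrictScalars_bot, sup_bot_eq] at h1
    rw [hF, Set.image_comp, ← Submodule.map_span]
    exact ⟨_, h1, twist_twist 1 f⟩

end Symbols

section QuantumDeterminant

/-- The quantum determinant at a point commutes with the generating series at another point, up to
the difference of the points. -/
lemma mul_qdet_comm {S : Type*} [Ring S] (z : S) (a b c : Fin 2 → Fin 2 → S)
    (hza : ∀ i j, a i j * z = z * a i j)
    (hac : ∀ i j k l, z * (a i j * c k l - c k l * a i j) = a k j * c i l - c k j * a i l)
    (hca : ∀ i j k l, -z * (c i j * a k l - a k l * c i j) = c k j * a i l - a k j * c i l)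
    (hbc : ∀ i j k l,
      (z - 1) * (b i j * c k l - c k l * b i j) = b k j * c i l - c k j * b i l)
    (hcb : ∀ i j k l,
      -(z - 1) * (c i j * b k l - b k l * c i j) = c k j * b i l - b k j * c i l)
    (hab : ∀ i j k l, a i j * b k l - b k l * a i j = a k j * b i l - b k j * a i l)
    (k l : Fin 2) :
    z * (z - 1) * ((a 0 0 * b 1 1 - a 1 0 * b 0 1) * c k l -
      c k l * (a 0 0 * b 1 1 - a 1 0 * b 0 1)) = 0 := by
  have hza' : ∀ i j y, a i j * (z * y) = z * (a i j * y) := fun i j y => by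
    rw [← mul_assoc, hza, mul_assoc]
  match k, l with
  | 0, 0 =>
      linear_combination (norm := skip)
        z * (a 0 0 * hcb 0 0 1 1) + z * (hab 1 0 0 0 * c 0 1) + hac 1 0 0 0 * b 0 1 - z
        * (a 1 0 * hcb 0 0 0 1) + z * (hac 0 0 0 0 * b 1 1) - z * (hca 0 0 1 0 * b 0 1)
        + hca 1 0 0 0 * b 0 1
      simp only [mul_sub, sub_mul, neg_mul, mul_neg, mul_assoc, hza', mul_one, one_mul, neg_sub]
      abel
  | 0, 1 =>
      linear_combination (norm := skip)
        z * (a 0 0 * hbc 1 1 0 1) + z * (hac 0 0 0 1 * b 1 1) + a 0 0 * hcb 1 1 0 1 -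
        hca 1 0 0 1 * b 0 1 - z * (hac 1 0 0 1 * b 0 1) + z * (c 0 0 * hab 1 1 0 1) - c
        0 0 * hab 1 1 0 1 - hac 0 0 0 1 * b 1 1 - z * (a 1 0 * hbc 0 1 0 1) - a 1 0 *
        hcb 0 1 0 1 + z * (hca 1 1 0 0 * b 0 1) - z * (hac 0 0 1 1 * b 0 1)
      simp only [mul_sub, sub_mul, neg_mul, mul_neg, mul_assoc, hza', mul_one, one_mul, neg_sub]
      abel
  | 1, 0 =>
      linear_combination (norm := skip)
        z * (hac 0 0 1 0 * b 1 1) + z * (a 0 0 * hcb 1 0 1 1) - z * (hac 1 0 1 0 * b 0 1) -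
          z * (a 1 0 * hcb 1 0 0 1) - z * (hab 0 0 1 0 * c 1 1)
      simp only [mul_sub, sub_mul, mul_assoc, hza', mul_one, one_mul, neg_sub]
      abel
  | 1, 1 =>
      linear_combination (norm := skip)
        z * (a 0 0 * hcb 1 1 1 1) + z * (hac 0 0 1 1 * b 1 1) - hac 0 0 1 1 * b 1 1 - z
        * (c 1 0 * hab 0 1 1 1) - z * (a 1 0 * hbc 0 1 1 1) - a 0 0 * hcb 1 1 1 1 - a 1
        0 * hcb 0 1 1 1 - z * (hac 1 0 1 1 * b 0 1) + hac 1 0 1 1 * b 0 1 - c 1 0 * hab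
        1 1 0 1
      simp only [mul_sub, sub_mul, mul_assoc, hza', mul_one, one_mul, neg_sub]
      abel

end QuantumDeterminant

section Rtt

variable {S : Type*} [Ring S]

/-- The defining relations of the Yangian, in the form of the coefficients of the RTT relation. -/
def IsRtt (t : Fin 2 → Fin 2 → ℕ → S) : Prop :=
  ∀ i j k l r s, t i j (r + 1) * t k l s - t k l s * t i j (r + 1) -
    (t i j r * t k l (s + 1) - t k l (s + 1) * t i j r) = t k j r * t i l s - t k j s * t i l r

lemma sub_eq_of_eq_sum_min {G F : ℕ → ℕ → S}
    (hF : ∀ a b, F a b = -F b a) (hF' : ∀ a, F a a = 0)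
    (hG : ∀ r s, G r s = ∑ a ∈ Finset.range (min r s), F a (r + s - 1 - a)) (r s : ℕ) :
    G (r + 1) s - G r (s + 1) = F r s := by
  rw [hG, hG, show r + 1 + s - 1 = r + s by omega, show r + (s + 1) - 1 = r + s by omega]
  rcases lt_trichotomy r s with h | rfl | h
  · rw [min_eq_left (by omega), min_eq_left (by omega), Finset.sum_range_succ]
    simp
  · simp [hF']
  · rw [min_eq_right (by omega), min_eq_right (by omega), Finset.sum_range_succ, hF r s]
    simp

lemma eq_sum_min_of_sub_eq {G F : ℕ → ℕ → S} (hF : ∀ a b, F a b = -F b a)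
    (h0 : ∀ s, G 0 s = 0) (h0' : ∀ r, G r 0 = 0)
    (hG : ∀ r s, G (r + 1) s - G r (s + 1) = F r s) (r s : ℕ) :
    G r s = ∑ a ∈ Finset.range (min r s), F a (r + s - 1 - a) := by
  have left : ∀ r s, G r s = ∑ a ∈ Finset.range r, F a (r + s - 1 - a) := by
    intro r
    induction r with
    | zero => simp [h0]
    | succ r ih =>
      intro s
      rw [Finset.sum_range_succ, show r + 1 + s - 1 = r + (s + 1) - 1 by omega, ← ih (s + 1),
        show r + (s + 1) - 1 - r = s by omega, ← hG]
      abel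
  have right : ∀ s r, G r s = ∑ a ∈ Finset.range s, F a (r + s - 1 - a) := by
    intro s
    induction s with
    | zero => simp [h0']
    | succ s ih =>
      intro r
      rw [Finset.sum_range_succ, show r + (s + 1) - 1 = r + 1 + s - 1 by omega, ← ih (r + 1),
        show r + 1 + s - 1 - s = r by omega, hF s r, ← hG]
      abel
  rcases le_total r s with h | h
  · rw [min_eq_left h, left]
  · rw [min_eq_right h, right]

variable {K : Type} [Field K] {p : ℕ}

lemma tY_zero (i j : Fin 2) : tY K p i j 0 = if i = j then 1 else 0 := by
  unfold tY tF
  rw [dif_pos rfl]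
  split_ifs <;> simp

lemma tY_of_lt {i j : Fin 2} {r : ℕ} (h : p < r) : tY K p i j r = 0 := by
  unfold tY tF
  rw [dif_neg (by omega), dif_neg (by omega), map_zero]

lemma tY_bracket (i j k l : Fin 2) (r s : ℕ) :
    tY K p i j r * tY K p k l s - tY K p k l s * tY K p i j r =
      ∑ a ∈ Finset.range (min r s), (tY K p k j a * tY K p i l (r + s - 1 - a) -
        tY K p k j (r + s - 1 - a) * tY K p i l a) := by
  rcases Nat.eq_zero_or_pos r with rfl | hr
  · simp only [tY_zero, zero_min, Finset.range_zero, Finset.sum_empty]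
    split_ifs <;> simp
  rcases Nat.eq_zero_or_pos s with rfl | hs
  · simp only [tY_zero, min_zero, Finset.range_zero, Finset.sum_empty]
    split_ifs <;> simp
  by_cases h : p < r ∨ p < s
  · rw [Finset.sum_eq_zero]
    · rcases h with h | h <;> simp [tY_of_lt h]
    · intro a ha
      rw [Finset.mem_range] at ha
      rw [tY_of_lt (r := r + s - 1 - a) (by omega), tY_of_lt (r := r + s - 1 - a) (by omega)]
      simp
  · push Not at h
    have := RingQuot.mkAlgHom_rel K (YRel.rel (K := K) (p := p) i j k l r s hr h.1 hs h.2)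
    simp only [map_sub, map_mul, map_sum] at this
    rw [show (∑ a ∈ Finset.range (min r s), (tY K p k j a * tY K p i l (r + s - 1 - a) -
        tY K p k j (r + s - 1 - a) * tY K p i l a)) = _ from
      Finset.sum_bij (t := Finset.Icc 1 (min r s)) (g := fun a => tY K p k j (a - 1) *
        tY K p i l (r + s - a) - tY K p k j (r + s - a) * tY K p i l (a - 1))
        (fun a _ => a + 1) (fun a ha => by simp at ha ⊢; omega) (by simp)
        (fun b hb => ⟨b - 1, by simp at hb ⊢; omega⟩)
        (fun a _ => by simp [show r + s - 1 - a = r + s - (a + 1) by omega])]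
    exact this

lemma isRtt_tY : IsRtt (tY K p) := fun i j k l r s =>
  sub_eq_of_eq_sum_min (G := fun r s => tY K p i j r * tY K p k l s - tY K p k l s * tY K p i j r)
    (F := fun a b => tY K p k j a * tY K p i l b - tY K p k j b * tY K p i l a)
    (fun a b => by simp) (fun a => by simp) (tY_bracket i j k l) r s

lemma IsRtt.bracket {t : Fin 2 → Fin 2 → ℕ → S} (h : IsRtt t)
    (h0 : ∀ i j, t i j 0 = if i = j then 1 else 0) (i j k l : Fin 2) (r s : ℕ) :
    t i j r * t k l s - t k l s * t i j r =
      ∑ a ∈ Finset.range (min r s), (t k j a * t i l (r + s - 1 - a) -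
        t k j (r + s - 1 - a) * t i l a) :=
  eq_sum_min_of_sub_eq (G := fun r s => t i j r * t k l s - t k l s * t i j r)
    (F := fun a b => t k j a * t i l b - t k j b * t i l a) (fun a b => by simp)
    (fun s => by simp only [h0]; split_ifs <;> simp)
    (fun s => by simp only [h0]; split_ifs <;> simp) (h i j k l) r s

/-- A family satisfying the RTT relations, truncated at level `p`, is a representation of `Y_p`. -/
noncomputable def ofRtt {A : Type*} [Ring A] [Algebra K A] (t : Fin 2 → Fin 2 → ℕ → A)
    (h : IsRtt t) (h0 : ∀ i j, t i j 0 = if i = j then 1 else 0)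
    (hp : ∀ i j r, p < r → t i j r = 0) : Yp K p →ₐ[K] A :=
  RingQuot.liftAlgHom K (s := YRel K p)
    ⟨FreeAlgebra.lift K fun g : YGen p => t g.1 g.2.1 (g.2.2 + 1), by
      have key : ∀ i j r, FreeAlgebra.lift K (fun g : YGen p => t g.1 g.2.1 (g.2.2 + 1))
          (tF K p i j r) = t i j r := by
        intro i j r
        unfold tF
        split_ifs with h1 h2 h3
        · simp [h1, h0, h2]
        · simp [h1, h0, h2]
        · simp [Nat.sub_add_cancel (Nat.one_le_iff_ne_zero.2 h1)]
        · simp [hp i j r (by omega)]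
      rintro _ _ ⟨i, j, k, l, r, s, hr, -, hs, -⟩
      simp only [map_sub, map_mul, map_sum, key]
      rw [h.bracket h0]
      exact Finset.sum_bij (fun a _ => a + 1) (fun a ha => by simp at ha ⊢; omega) (by simp)
        (fun b hb => ⟨b - 1, by simp at hb ⊢; omega⟩)
        (fun a _ => by simp [show r + s - 1 - a = r + s - (a + 1) by omega])⟩

lemma ofRtt_tY {A : Type*} [Ring A] [Algebra K A] (t : Fin 2 → Fin 2 → ℕ → A)
    (h : IsRtt t) (h0 : ∀ i j, t i j 0 = if i = j then 1 else 0)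
    (hp : ∀ i j r, p < r → t i j r = 0) (i j : Fin 2) (r : ℕ) :
    ofRtt (K := K) t h h0 hp (tY K p i j r) = t i j r := by
  unfold ofRtt tY
  rw [RingQuot.liftAlgHom_mkAlgHom_apply]
  unfold tF
  split_ifs with h1 h2 h3
  · simp [h1, h0, h2]
  · simp [h1, h0, h2]
  · simp [Nat.sub_add_cancel (Nat.one_le_iff_ne_zero.2 h1)]
  · simp [hp i j r (by omega)]

/-- The generating series of a family truncated at level `p`, at a point. -/
noncomputable def series (p : ℕ) (t : Fin 2 → Fin 2 → ℕ → S) (x : S) (i j : Fin 2) : S :=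
  ∑ r ∈ Finset.range (p + 1), t i j r * x ^ (p - r)

lemma IsRtt.series_bracket {t : Fin 2 → Fin 2 → ℕ → S} (h : IsRtt t)
    (h0 : ∀ i j, t i j 0 = if i = j then 1 else 0) (hp : ∀ i j r, p < r → t i j r = 0)
    {x y : S} (hx : ∀ z, Commute x z) (hy : ∀ z, Commute y z) (i j k l : Fin 2) :
    (x - y) * (series p t x i j * series p t y k l - series p t y k l * series p t x i j) =
      series p t x k j * series p t y i l - series p t y k j * series p t x i l := by
  have e1 : ∀ (u v : ℕ → S), (∑ r ∈ Finset.range (p + 1), u r * x ^ (p - r)) *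
      (∑ s ∈ Finset.range (p + 1), v s * y ^ (p - s)) =
      ∑ r ∈ Finset.range (p + 1), ∑ s ∈ Finset.range (p + 1),
        u r * v s * (x ^ (p - r) * y ^ (p - s)) := by
    intro u v
    rw [Finset.sum_mul_sum]
    refine Finset.sum_congr rfl fun r _ => Finset.sum_congr rfl fun s _ => ?_
    rw [mul_assoc, ← mul_assoc (x ^ _), ((hx (v s)).pow_left _).eq]
    simp only [mul_assoc]
  have e2 : ∀ (u v : ℕ → S), (∑ r ∈ Finset.range (p + 1), u r * y ^ (p - r)) *
      (∑ s ∈ Finset.range (p + 1), v s * x ^ (p - s)) =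
      ∑ r ∈ Finset.range (p + 1), ∑ s ∈ Finset.range (p + 1),
        u s * v r * (x ^ (p - r) * y ^ (p - s)) := by
    intro u v
    rw [Finset.sum_mul_sum, Finset.sum_comm]
    refine Finset.sum_congr rfl fun r _ => Finset.sum_congr rfl fun s _ => ?_
    rw [mul_assoc, ← mul_assoc (y ^ _), ((hy (v r)).pow_left _).eq, mul_assoc (v r),
      ((hy (x ^ (p - r))).pow_left (p - s)).eq]
    simp only [mul_assoc]
  unfold series
  rw [e1, e2, e1, e2, ← Finset.sum_sub_distrib, ← Finset.sum_sub_distrib]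
  simp only [← Finset.sum_sub_distrib, ← sub_mul]
  set G : ℕ → ℕ → S := fun r s => t i j r * t k l s - t k l s * t i j r with hG
  have hG0 : ∀ s, G 0 s = 0 := fun s => by simp only [hG, h0]; split_ifs <;> simp
  have hG0' : ∀ s, G s 0 = 0 := fun s => by simp only [hG, h0]; split_ifs <;> simp
  have hGp : ∀ s, G (p + 1) s = 0 := fun s => by simp [hG, hp _ _ (p + 1)]
  have hGp' : ∀ s, G s (p + 1) = 0 := fun s => by simp [hG, hp _ _ (p + 1)]
  have hX : x * ∑ r ∈ Finset.range (p + 1), ∑ s ∈ Finset.range (p + 1),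
      G r s * (x ^ (p - r) * y ^ (p - s)) = ∑ r ∈ Finset.range (p + 1),
        ∑ s ∈ Finset.range (p + 1), G (r + 1) s * (x ^ (p - r) * y ^ (p - s)) := by
    rw [Finset.sum_range_succ', Finset.sum_range_succ (fun r => ∑ s ∈ Finset.range (p + 1),
      G (r + 1) s * (x ^ (p - r) * y ^ (p - s)))]
    simp only [hG0, hGp, zero_mul, Finset.sum_const_zero, add_zero, Finset.mul_sum]
    refine Finset.sum_congr rfl fun r hr => Finset.sum_congr rfl fun s _ => ?_
    rw [← mul_assoc, (hx _).eq, mul_assoc, ← mul_assoc x, ← pow_succ',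
      show p - (r + 1) + 1 = p - r by rw [Finset.mem_range] at hr; omega]
  have hY : y * ∑ r ∈ Finset.range (p + 1), ∑ s ∈ Finset.range (p + 1),
      G r s * (x ^ (p - r) * y ^ (p - s)) = ∑ r ∈ Finset.range (p + 1),
        ∑ s ∈ Finset.range (p + 1), G r (s + 1) * (x ^ (p - r) * y ^ (p - s)) := by
    rw [Finset.mul_sum]
    refine Finset.sum_congr rfl fun r _ => ?_
    rw [Finset.sum_range_succ', Finset.sum_range_succ]
    simp only [hG0', hGp', zero_mul, add_zero, Finset.mul_sum]
    refine Finset.sum_congr rfl fun s hs => ?_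
    rw [← mul_assoc, (hy _).eq, mul_assoc, ← mul_assoc y, (hy (x ^ _)).eq, mul_assoc (x ^ _),
      ← pow_succ', show p - (s + 1) + 1 = p - s by rw [Finset.mem_range] at hs; omega]
  rw [sub_mul, hX, hY, ← Finset.sum_sub_distrib]
  refine Finset.sum_congr rfl fun r _ => ?_
  rw [← Finset.sum_sub_distrib]
  refine Finset.sum_congr rfl fun s _ => ?_
  rw [← sub_mul, ← h i j k l r s]

end Rtt

section Gamma

variable {K : Type} [Field K] {p : ℕ}

lemma tY_succ (g : YGen p) : tY K p g.1 g.2.1 (g.2.2 + 1) =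
    RingQuot.mkAlgHom K (YRel K p) (FreeAlgebra.ι K g) := by
  unfold tY tF
  rw [dif_neg (by omega), dif_pos (by omega)]
  rfl

lemma Yp_induction {P : Yp K p → Prop} (hc : ∀ c : K, P (algebraMap K _ c))
    (ht : ∀ g : YGen p, P (tY K p g.1 g.2.1 (g.2.2 + 1))) (ha : ∀ x y, P x → P y → P (x + y))
    (hm : ∀ x y, P x → P y → P (x * y)) (y : Yp K p) : P y := by
  obtain ⟨f, rfl⟩ := RingQuot.mkAlgHom_surjective K (YRel K p) y
  induction f using FreeAlgebra.induction with
  | grade0 c => simpa using hc c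
  | grade1 g => simpa [tY_succ] using ht g
  | mul f g hf hg => simpa using hm _ _ hf hg
  | add f g hf hg => simpa using ha _ _ hf hg

lemma IsRtt.map {S S' : Type*} [Ring S] [Ring S'] {t : Fin 2 → Fin 2 → ℕ → S} (h : IsRtt t)
    (φ : S →+* S') : IsRtt fun i j r => φ (t i j r) := fun i j k l r s => by
  simp only [← map_mul, ← map_sub]
  rw [h i j k l r s]

lemma TY_eq (i j : Fin 2) :
    TY K p i j = ∑ r ∈ Finset.range (p + 1), C (tY K p i j r) * X ^ (p - r) := by
  rw [Finset.sum_range_succ', TY, add_comm]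
  congr 1
  · exact (Finset.sum_bij (fun a _ => a + 1) (fun a ha => by simp at ha ⊢; omega) (by simp)
      (fun b hb => ⟨b - 1, by simp at hb ⊢; omega⟩) (fun a _ => rfl)).symm
  · rw [tY_zero]
    split_ifs <;> simp

lemma commute_C_X {S : Type*} [Ring S] (f : S[X][X]) : Commute (C X) f := by
  ext1 n
  rw [coeff_C_mul, coeff_mul_C, X_mul]

lemma eq_zero_of_C_sub_X_mul {S : Type*} [Ring S] {a : S} {f : S[X]} (h : (C a - X) * f = 0) :
    f = 0 := by
  have : (X - C a) * f = 0 := by rw [← neg_sub, neg_mul, h, neg_zero]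
  exact (monic_X_sub_C a).isRegular.left.eq_iff.1 (this.trans (mul_zero _).symm)

lemma IsRtt.qdet_commute {S : Type*} [Ring S] {τ : Fin 2 → Fin 2 → ℕ → S} (hτ : IsRtt τ)
    (h0 : ∀ i j, τ i j 0 = if i = j then 1 else 0) (hp : ∀ i j r, p < r → τ i j r = 0)
    {T : Fin 2 → Fin 2 → S[X]}
    (hT : ∀ i j, T i j = ∑ r ∈ Finset.range (p + 1), C (τ i j r) * X ^ (p - r))
    (k l : Fin 2) (r : ℕ) :
    Commute (T 0 0 * (T 1 1).comp (X - 1) - T 1 0 * (T 0 1).comp (X - 1)) (C (τ k l r)) := by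
  rcases lt_or_ge p r with hr | hr
  · rw [hp _ _ _ hr, map_zero]
    exact Commute.zero_right _
  have T_comp : ∀ i j, (T i j).comp (X - 1) =
      ∑ r ∈ Finset.range (p + 1), C (τ i j r) * (X - 1) ^ (p - r) := fun i j => by
    rw [hT, sum_comp]
    refine Finset.sum_congr rfl fun r _ => ?_
    rw [mul_X_pow_comp, C_comp]
  let t : Fin 2 → Fin 2 → ℕ → S[X][X] := fun i j r => C (C (τ i j r))
  have ht : IsRtt t := hτ.map ((C : S[X] →+* _).comp C)
  have ht0 : ∀ i j, t i j 0 = if i = j then 1 else 0 := fun i j => by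
    simp only [t, h0]; split_ifs <;> simp
  have htp : ∀ i j r, p < r → t i j r = 0 := fun i j r hr => by simp [t, hp _ _ _ hr]
  have c1 : ∀ f : S[X][X], Commute (C X) f := commute_C_X
  have c2 : ∀ f : S[X][X], Commute (C (X - 1)) f := fun f => by
    rw [map_sub, map_one]; exact (c1 f).sub_left (Commute.one_left f)
  have c3 : ∀ f : S[X][X], Commute X f := commute_X
  have hA : C (T 0 0 * (T 1 1).comp (X - 1) - T 1 0 * (T 0 1).comp (X - 1)) =
      series p t (C X) 0 0 * series p t (C (X - 1)) 1 1 -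
      series p t (C X) 1 0 * series p t (C (X - 1)) 0 1 := by
    simp only [T_comp, series, t, ← map_pow, ← map_mul, ← map_sum, ← map_sub]
    rw [hT, hT]
  have key := mul_qdet_comm (C X - X) (series p t (C X)) (series p t (C (X - 1))) (series p t X)
    (fun i j => (((c1 _).sub_left (c3 _)).eq).symm)
    (ht.series_bracket ht0 htp c1 c3)
    (fun i j k l => by rw [neg_sub]; exact ht.series_bracket ht0 htp c3 c1 i j k l)
    (fun i j k l => by
      rw [show (C X - X - 1 : S[X][X]) = C (X - 1) - X by rw [map_sub, map_one]; abel]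
      exact ht.series_bracket ht0 htp c2 c3 i j k l)
    (fun i j k l => by
      rw [show (-(C X - X - 1) : S[X][X]) = X - C (X - 1) by rw [map_sub, map_one]; abel]
      exact ht.series_bracket ht0 htp c3 c2 i j k l)
    (fun i j k l => by
      have := ht.series_bracket ht0 htp c1 c2 i j k l
      rwa [show (C X - C (X - 1) : S[X][X]) = 1 by rw [map_sub, map_one]; abel,
        one_mul] at this) k l
  rw [mul_assoc] at key
  have key2 := eq_zero_of_C_sub_X_mul key
  rw [show (C X - X - 1 : S[X][X]) = C (X - 1) - X by rw [map_sub, map_one]; abel] at key2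
  have key3 := eq_zero_of_C_sub_X_mul key2
  rw [← hA] at key3
  have key4 := congrArg (fun f => coeff f (p - r)) key3
  simp only [coeff_sub, coeff_C_mul, coeff_mul_C, coeff_zero] at key4
  have hc : (series p t X k l).coeff (p - r) = C (τ k l r) := by
    simp only [series, t, finsetSum_coeff, coeff_C_mul, coeff_X_pow]
    rw [Finset.sum_eq_single r]
    · simp
    · intro b hb hbr
      rw [Finset.mem_range] at hb
      rw [if_neg (by omega), mul_zero]
    · intro h
      rw [Finset.mem_range] at h
      omega
  rw [hc] at key4
  exact sub_eq_zero.1 key4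

lemma DY_commute (k l : Fin 2) (r : ℕ) : Commute (DY K p) (C (tY K p k l r)) :=
  isRtt_tY.qdet_commute tY_zero (fun _ _ _ h => tY_of_lt h) TY_eq k l r

lemma dY_commute (i : ℕ) (y : Yp K p) : Commute (dY K p i) y := by
  induction y using Yp_induction with
  | hc c => exact (Algebra.commutes c _).symm
  | ht g =>
    have := congrArg (fun f => coeff f (2 * p - i))
      (DY_commute (K := K) (p := p) g.1 g.2.1 (g.2.2 + 1)).eq
    simp only [coeff_C_mul, coeff_mul_C] at this
    exact this
  | ha x y hx hy => exact hx.add_right hy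
  | hm x y hx hy => exact hx.mul_right hy

lemma tY_commute (i j : Fin 2) (r s : ℕ) : Commute (tY K p i j r) (tY K p i j s) := by
  induction r generalizing s with
  | zero =>
    rw [tY_zero]
    split_ifs
    · exact Commute.one_left _
    · exact Commute.zero_left _
  | succ r ih =>
    have h1 := isRtt_tY (K := K) (p := p) i j i j r s
    rw [(ih (s + 1)).eq, sub_self, sub_zero, (ih s).eq, sub_self] at h1
    exact sub_eq_zero.1 h1

lemma gseq_commute (l m : ℕ) :
    Commute (gseq p (dY K p) (tY K p 1 1) l) (gseq p (dY K p) (tY K p 1 1) m) := by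
  unfold gseq
  split_ifs
  all_goals first
    | exact dY_commute _ _
    | exact (dY_commute _ _).symm
    | exact tY_commute _ _ _ _

end Gamma

section Symbols

variable {K : Type} [Field K] {p : ℕ} {Y : Type*} [Ring Y] [Algebra K Y]
  {τ : Fin 2 → Fin 2 → ℕ → Y}

/-- The generators of a family truncated at level `p`. -/
def gens (p : ℕ) {Y : Type*} (τ : Fin 2 → Fin 2 → ℕ → Y) (g : YGen p) : Y :=
  τ g.1 g.2.1 (g.2.2 + 1)

lemma rtt_mem_filt (h0 : ∀ i j, τ i j 0 = if i = j then 1 else 0)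
    (hp : ∀ i j r, p < r → τ i j r = 0) (i j : Fin 2) (r : ℕ) :
    τ i j r ∈ filt K (gw p) (gens p τ) (r + 1) := by
  rcases Nat.eq_zero_or_pos r with rfl | hr
  · rw [h0]
    split_ifs
    · exact one_mem_filt
    · exact zero_mem _
  · rcases lt_or_ge p r with h | h
    · rw [hp _ _ _ h]
      exact zero_mem _
    · obtain ⟨r, rfl⟩ := Nat.exists_eq_succ_of_ne_zero hr.ne'
      exact gen_mem_filt (K := K) (w := gw p) (t := gens p τ) (i, j, ⟨r, h⟩)

lemma rtt_comm_mem_filt (hτ : IsRtt τ) (h0 : ∀ i j, τ i j 0 = if i = j then 1 else 0)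
    (hp : ∀ i j r, p < r → τ i j r = 0) (g h : YGen p) :
    gens p τ g * gens p τ h - gens p τ h * gens p τ g ∈
      filt K (gw p) (gens p τ) (gw p g + gw p h) := by
  unfold gens
  rw [hτ.bracket h0]
  refine Submodule.sum_mem _ fun a ha => ?_
  rw [Finset.mem_range] at ha
  unfold gw
  exact sub_mem
    (filt_mul_of_add (fun m n _ _ => by omega) (rtt_mem_filt h0 hp _ _ _)
      (rtt_mem_filt h0 hp _ _ _))
    (filt_mul_of_add (fun m n _ _ => by omega) (rtt_mem_filt h0 hp _ _ _)
      (rtt_mem_filt h0 hp _ _ _))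

lemma lifts_one (w : YGen p → ℕ) (t : YGen p → Y) :
    Lifts w t 0 (1 : Y) (1 : MvPolynomial (YGen p) K) := by
  refine ⟨MvPolynomial.isWeightedHomogeneous_one K w, ?_⟩
  have := ordMap_monomial (K := K) (t := t) 0
  rw [show (MvPolynomial.monomial (0 : YGen p →₀ ℕ) (1 : K)) = 1 from rfl] at this
  simp [this]

lemma lifts_X (w : YGen p → ℕ) (t : YGen p → Y) (g : YGen p) :
    Lifts w t (w g) (t g) (MvPolynomial.X g : MvPolynomial (YGen p) K) := by
  refine ⟨MvPolynomial.isWeightedHomogeneous_X K w g, ?_⟩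
  have := ordMap_monomial (K := K) (t := t) (Finsupp.single g 1)
  rw [show (MvPolynomial.monomial (Finsupp.single g 1) (1 : K)) = MvPolynomial.X g from rfl] at this
  simp [this]

lemma lifts_xR (h0 : ∀ i j, τ i j 0 = if i = j then 1 else 0)
    (hp : ∀ i j r, p < r → τ i j r = 0) (i j : Fin 2) (r : ℕ) :
    Lifts (gw p) (gens p τ) r (τ i j r) (xR K p i j r) := by
  rcases Nat.eq_zero_or_pos r with rfl | hr
  · rw [h0, xR_zero]
    split_ifs
    · exact lifts_one _ _
    · exact lifts_zero (zero_mem _)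
  · rcases lt_or_ge p r with h | h
    · rw [hp _ _ _ h, xR_of_lt h]
      exact lifts_zero (zero_mem _)
    · rw [xR_eq_X hr h]
      convert lifts_X (K := K) (gw p) (gens p τ) (i, j, ⟨r - 1, by omega⟩) using 1
      · simp [gw, Nat.sub_add_cancel hr]
      · simp [gens, Nat.sub_add_cancel hr]

lemma coeff_X_pow_mul_X_sub_one_pow (a b n : ℕ) (h : a + b ≤ n) :
    ((X : K[X]) ^ a * (X - 1) ^ b).coeff n = if a + b = n then 1 else 0 := by
  have hm : ((X : K[X]) ^ a * (X - 1) ^ b).Monic :=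
    (monic_X_pow a).mul ((monic_X_sub_C (1 : K)).pow b)
  have hd : ((X : K[X]) ^ a * (X - 1) ^ b).natDegree = a + b := by
    rw [← C_1, (monic_X_pow a).natDegree_mul ((monic_X_sub_C (1 : K)).pow b), natDegree_X_pow,
      (monic_X_sub_C (1 : K)).natDegree_pow, natDegree_X_sub_C, mul_one]
  split_ifs with hn
  · rw [← hn, ← hd]
    exact hm
  · exact coeff_eq_zero_of_natDegree_lt (by omega)

lemma coeff_C_mul_X_pow_mul_X_sub_one_pow (y z : Y) (a b n : ℕ) :
    ((C y * X ^ a * (C z * (X - 1) ^ b)) : Y[X]).coeff n =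
      ((X : K[X]) ^ a * (X - 1) ^ b).coeff n • (y * z) := by
  have h : ((X : Y[X]) ^ a * (X - 1) ^ b) =
      ((X : K[X]) ^ a * (X - 1) ^ b).map (algebraMap K Y) := by
    simp
  rw [mul_assoc, ← mul_assoc (X ^ a), X_pow_mul_C, mul_assoc, h, coeff_C_mul, coeff_C_mul,
    coeff_map, ← Algebra.commutes, ← mul_assoc, ← Algebra.commutes, Algebra.smul_def, mul_assoc]

lemma lifts_qdet (h0 : ∀ i j, τ i j 0 = if i = j then 1 else 0)
    (hp : ∀ i j r, p < r → τ i j r = 0) (hτ : IsRtt τ) {T : Fin 2 → Fin 2 → Y[X]}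
    (hT : ∀ i j, T i j = ∑ r ∈ Finset.range (p + 1), C (τ i j r) * X ^ (p - r))
    {i : ℕ} (hi : i ≤ 2 * p) :
    Lifts (gw p) (gens p τ) i
      ((T 0 0 * (T 1 1).comp (X - 1) - T 1 0 * (T 0 1).comp (X - 1)).coeff (2 * p - i))
      (delta K p i) := by
  have hc := rtt_comm_mem_filt (K := K) hτ h0 hp
  have T_comp : ∀ i j, (T i j).comp (X - 1) =
      ∑ r ∈ Finset.range (p + 1), C (τ i j r) * (X - 1) ^ (p - r) := fun i j => by
    rw [hT, sum_comp]
    refine Finset.sum_congr rfl fun r _ => ?_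
    rw [mul_X_pow_comp, C_comp]
  have hdelta : delta K p i = ∑ a ∈ Finset.range (p + 1) ×ˢ Finset.range (p + 1),
      if a.1 + a.2 = i then (xR K p 0 0 a.1 * xR K p 1 1 a.2 - xR K p 1 0 a.1 * xR K p 0 1 a.2)
      else 0 := by
    rw [← Finset.sum_filter, delta]
    symm
    apply Finset.sum_subset
    · intro a ha
      rw [Finset.HasAntidiagonal.mem_antidiagonal]
      exact (Finset.mem_filter.1 ha).2
    · intro a ha ha'
      rw [Finset.HasAntidiagonal.mem_antidiagonal] at ha
      have : p < a.1 ∨ p < a.2 := by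
        by_contra! h
        exact ha' (by simp [ha]; omega)
      rcases this with h | h <;> simp [xR_of_lt h]
  rw [hdelta, T_comp, T_comp, hT, hT, Finset.sum_mul_sum, Finset.sum_mul_sum,
    ← Finset.sum_sub_distrib]
  simp_rw [← Finset.sum_sub_distrib]
  rw [← Finset.sum_product', finsetSum_coeff]
  refine Lifts.sum _ fun a ha => ?_
  rw [Finset.mem_product, Finset.mem_range, Finset.mem_range] at ha
  rw [coeff_sub, coeff_C_mul_X_pow_mul_X_sub_one_pow (K := K),
    coeff_C_mul_X_pow_mul_X_sub_one_pow (K := K), ← smul_sub]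
  have hl : Lifts (gw p) (gens p τ) (a.1 + a.2) (τ 0 0 a.1 * τ 1 1 a.2 - τ 1 0 a.1 * τ 0 1 a.2)
      (xR K p 0 0 a.1 * xR K p 1 1 a.2 - xR K p 1 0 a.1 * xR K p 0 1 a.2) :=
    ((lifts_xR h0 hp _ _ _).mul hc (lifts_xR h0 hp _ _ _)).sub
      ((lifts_xR h0 hp _ _ _).mul hc (lifts_xR h0 hp _ _ _))
  rcases lt_or_ge (a.1 + a.2) i with h | h
  · rw [if_neg (by omega)]
    refine lifts_zero (Submodule.smul_mem _ _ (sub_mem ?_ ?_))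
    · exact filt_mul_of_add (fun m n _ _ => by omega) (rtt_mem_filt h0 hp _ _ _)
        (rtt_mem_filt h0 hp _ _ _)
    · exact filt_mul_of_add (fun m n _ _ => by omega) (rtt_mem_filt h0 hp _ _ _)
        (rtt_mem_filt h0 hp _ _ _)
  · rw [coeff_X_pow_mul_X_sub_one_pow _ _ _ (by omega)]
    by_cases hai : a.1 + a.2 = i
    · rw [if_pos hai, if_pos (by omega), one_smul, ← hai]
      exact hl
    · rw [if_neg hai, if_neg (by omega), zero_smul]
      exact lifts_zero (zero_mem _)

lemma Lifts.emon {w : YGen p → ℕ} {t : YGen p → Y}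
    (hc : ∀ g h, t g * t h - t h * t g ∈ filt K w t (w g + w h)) {y : ℕ → Y}
    {f : ℕ → MvPolynomial (YGen p) K} {d : ℕ → ℕ} (n : ℕ) (h : ∀ l < n, Lifts w t (d l) (y l) (f l))
    (a : Ex n) : Lifts w t (ewt d n a) (emon y n a) (emon f n a) := by
  induction n with
  | zero => exact lifts_one w t
  | succ n ih =>
    exact (ih (fun l hl => h l (hl.trans n.lt_succ_self)) a.1).mul hc
      ((h n n.lt_succ_self).pow hc a.2)

end Symbols

section Assembly

lemma free_and_exists_isCompl {K Y : Type*} [Field K] [Ring Y] [Algebra K Y] (Γ : Subalgebra K Y)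
    {E N : Type*} (e : E → Y) (m : N → Y) (he : ∀ a, e a ∈ Γ)
    (hΓ : ∀ y ∈ Γ, y ∈ Submodule.span K (Set.range e))
    (hli : LinearIndependent K fun q : E × N => e q.1 * m q.2)
    (hsp : Submodule.span K (Set.range fun q : E × N => e q.1 * m q.2) = ⊤)
    {o : N} (ho : m o = 1) :
    Module.Free Γ Y ∧ ∃ P : Submodule Γ Y, IsCompl (Submodule.span Γ {(1 : Y)}) P := by
  classical
  have hli' : LinearIndependent Γ m := by
    rw [linearIndependent_iff']
    intro s g hg n hn
    have hc : ∀ n, ∃ c : E →₀ K, Finsupp.linearCombination K e c = g n := fun n =>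
      Finsupp.mem_span_range_iff_exists_finsupp.1 (hΓ _ (g n).2)
    choose c hc using hc
    let A := s.biUnion fun n => (c n).support
    have hgA : ∀ n ∈ s, (g n : Y) = ∑ a ∈ A, c n a • e a := fun n hn => by
      rw [← hc n]
      exact Finsupp.sum_of_support_subset _
        (Finset.subset_biUnion_of_mem (fun n => (c n).support) hn) _ (by simp)
    have h0 : ∑ q ∈ A ×ˢ s, c q.2 q.1 • (e q.1 * m q.2) = 0 := by
      rw [Finset.sum_product_right, ← hg]
      refine Finset.sum_congr rfl fun n hn => ?_
      rw [Subalgebra.smul_def, smul_eq_mul, hgA n hn, Finset.sum_mul]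
      simp
    have h1 := linearIndependent_iff'.1 hli _ (fun q => c q.2 q.1) h0
    have h2 := hgA n hn
    rw [Finset.sum_eq_zero fun a ha => by
      rw [h1 (a, n) (Finset.mem_product.2 ⟨ha, hn⟩), zero_smul]] at h2
    exact Subtype.ext h2
  have hsp' : ⊤ ≤ Submodule.span Γ (Set.range m) := by
    intro y _
    have hy : y ∈ Submodule.span K (Set.range fun q : E × N => e q.1 * m q.2) := hsp ▸ trivial
    induction hy using Submodule.span_induction with
    | mem x hx =>
      obtain ⟨q, rfl⟩ := hx
      exact Submodule.smul_mem _ (⟨e q.1, he _⟩ : Γ) (Submodule.subset_span ⟨q.2, rfl⟩)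
    | zero => exact zero_mem _
    | add x y _ _ hx hy => exact add_mem (hx trivial) (hy trivial)
    | smul c x _ hx =>
      have := Submodule.smul_mem _ (algebraMap K Γ c) (hx trivial)
      rwa [algebraMap_smul] at this
  refine ⟨Module.Free.of_basis (Module.Basis.mk hli' hsp'),
    Submodule.span Γ (m '' {o}ᶜ), ?_, ?_⟩
  · have := hli'.disjoint_span_image (s := {o}) (t := {o}ᶜ) disjoint_compl_right
    rwa [Set.image_singleton, ho] at this
  · rw [codisjoint_iff, ← Submodule.span_union, eq_top_iff]
    refine hsp'.trans (Submodule.span_mono ?_)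
    rintro _ ⟨n, rfl⟩
    by_cases hn : n = o
    · left
      rw [hn, ho, Set.mem_singleton_iff]
    · exact Or.inr ⟨n, hn, rfl⟩

lemma exists_emon_eq_one {M : Type*} [Monoid M] (h : ℕ → M) (n : ℕ) : ∃ a, emon h n a = 1 := by
  induction n with
  | zero => exact ⟨(), rfl⟩
  | succ n ih =>
    obtain ⟨a, ha⟩ := ih
    exact ⟨(a, 0), by simp [emon, ha]⟩

lemma exists_emon_eq {M : Type*} [Monoid M] (h : ℕ → M) {n l : ℕ} (hl : l < n) :
    ∃ a, emon h n a = h l := by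
  induction n with
  | zero => omega
  | succ n ih =>
    rcases Nat.lt_succ_iff_lt_or_eq.1 hl with hl | rfl
    · obtain ⟨a, ha⟩ := ih hl
      exact ⟨(a, 0), by simp [emon, ha]⟩
    · obtain ⟨a, ha⟩ := exists_emon_eq_one h l
      exact ⟨(a, 1), by simp [emon, ha]⟩

lemma commute_emon {M : Type*} [Monoid M] {h : ℕ → M} {y : M} (hy : ∀ l, Commute y (h l)) (n : ℕ)
    (a : Ex n) : Commute y (emon h n a) := by
  induction n with
  | zero => exact Commute.one_right _
  | succ n ih => exact (ih a.1).mul_right ((hy n).pow_right _)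

lemma exists_emon_mul {M : Type*} [Monoid M] {h : ℕ → M} (hh : ∀ l l', Commute (h l) (h l'))
    (n : ℕ) (a b : Ex n) : ∃ c, emon h n a * emon h n b = emon h n c := by
  induction n with
  | zero => exact ⟨(), mul_one _⟩
  | succ n ih =>
    obtain ⟨c, hc⟩ := ih a.1 b.1
    refine ⟨(c, a.2 + b.2), ?_⟩
    simp only [emon]
    rw [mul_assoc, ← mul_assoc (h n ^ a.2),
      ((commute_emon (hh n) n b.1).pow_left _).eq, mul_assoc, ← pow_add, ← mul_assoc, hc]

lemma adjoin_le_span_emon {K Y : Type*} [Field K] [Ring Y] [Algebra K Y] {h : ℕ → Y}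
    (hh : ∀ l l', Commute (h l) (h l')) {n : ℕ} {s : Set Y} (hs : ∀ y ∈ s, ∃ l < n, y = h l)
    (y : Y) (hy : y ∈ Algebra.adjoin K s) : y ∈ Submodule.span K (Set.range (emon h n)) := by
  rw [← Subalgebra.mem_toSubmodule, Algebra.adjoin_eq_span] at hy
  refine Submodule.span_mono ?_ hy
  intro z hz
  induction hz using Submonoid.closure_induction with
  | mem x hx =>
    obtain ⟨l, hl, rfl⟩ := hs x hx
    exact exists_emon_eq h hl
  | one => exact exists_emon_eq_one h n
  | mul x y _ _ hx hy =>
    obtain ⟨a, rfl⟩ := hx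
    obtain ⟨b, rfl⟩ := hy
    obtain ⟨c, hc⟩ := exists_emon_mul hh n a b
    exact ⟨c, hc.symm⟩

lemma emon_mem_subalgebra {K Y : Type*} [Field K] [Ring Y] [Algebra K Y] {h : ℕ → Y}
    (Γ : Subalgebra K Y) {n : ℕ} (hh : ∀ l < n, h l ∈ Γ) (a : Ex n) : emon h n a ∈ Γ := by
  induction n with
  | zero => exact one_mem _
  | succ n ih =>
    exact mul_mem (ih (fun l hl => hh l (hl.trans n.lt_succ_self)) a.1)
      (pow_mem (hh n n.lt_succ_self) _)

variable {K : Type} [Field K] {p : ℕ}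

theorem exists_prod_basis {Y : Type*} [Ring Y] [Algebra K Y] {τ : Fin 2 → Fin 2 → ℕ → Y}
    (hτ : IsRtt τ) (h0 : ∀ i j, τ i j 0 = if i = j then 1 else 0)
    (hp : ∀ i j r, p < r → τ i j r = 0) {T : Fin 2 → Fin 2 → Y[X]}
    (hT : ∀ i j, T i j = ∑ r ∈ Finset.range (p + 1), C (τ i j r) * X ^ (p - r))
    (hgen : ∀ y, ∃ N, y ∈ filt K (gw p) (gens p τ) N)
    (hinj : Function.Injective (ordMap K (gens p τ))) {h : ℕ → Y}
    (hh : h = gseq p (fun i => (T 0 0 * (T 1 1).comp (X - 1) -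
      T 1 0 * (T 0 1).comp (X - 1)).coeff (2 * p - i)) (τ 1 1)) :
    ∃ (N : Type) (m : N → Y), LinearIndependent K (fun q : Ex (3 * p) × N =>
      emon h (3 * p) q.1 * m q.2) ∧
      Submodule.span K (Set.range fun q : Ex (3 * p) × N => emon h (3 * p) q.1 * m q.2) = ⊤ ∧
      ∃ o, m o = 1 := by
  obtain ⟨N, m, wt, hm, hli, hsp, o, ho⟩ := exists_symbol_basis K p
  have hc := rtt_comm_mem_filt (K := K) hτ h0 hp
  have hl : ∀ l < 3 * p, Lifts (gw p) (gens p τ) (gseq p id id l) (h l)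
      (gseq p (delta K p) (xR K p 1 1) l) := by
    intro l hl
    rw [hh]
    unfold gseq
    split_ifs
    · exact lifts_qdet h0 hp hτ hT (show p + 1 + l ≤ 2 * p by omega)
    · exact lifts_qdet h0 hp hτ hT (show l - p + 1 ≤ 2 * p by omega)
    · exact lifts_xR h0 hp _ _ _
  have hlift : ∀ q : Ex (3 * p) × N, Lifts (gw p) (gens p τ)
      (ewt (gseq p id id) (3 * p) q.1 + wt q.2)
      (emon h (3 * p) q.1 * ordMap K (gens p τ) (m q.2))
      (emon (gseq p (delta K p) (xR K p 1 1)) (3 * p) q.1 * m q.2) := fun q =>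
    (Lifts.emon hc (3 * p) hl q.1).mul hc ⟨hm q.2, by rw [sub_self]; exact zero_mem _⟩
  refine ⟨N, fun n => ordMap K (gens p τ) (m n), linearIndependent_of_lifts hc hinj hlift hli,
    span_eq_top_of_lifts hc hgen hlift hsp, o, ?_⟩
  have := ordMap_monomial (K := K) (t := gens p τ) 0
  rw [show (MvPolynomial.monomial (0 : YGen p →₀ ℕ) (1 : K)) = 1 from rfl] at this
  simp [ho, this]

lemma exists_mem_filt (y : Yp K p) : ∃ N, y ∈ filt K (gw p) (gens p (tY K p)) N := by
  induction y using Yp_induction with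
  | hc c =>
    refine ⟨1, ?_⟩
    rw [Algebra.algebraMap_eq_smul_one]
    exact Submodule.smul_mem _ _ one_mem_filt
  | ht g => exact ⟨_, gen_mem_filt (t := gens p (tY K p)) g⟩
  | ha x y hx hy =>
    obtain ⟨M, hM⟩ := hx
    obtain ⟨N, hN⟩ := hy
    exact ⟨max M N, add_mem (filt_mono (le_max_left _ _) hM) (filt_mono (le_max_right _ _) hN)⟩
  | hm x y hx hy =>
    obtain ⟨M, hM⟩ := hx
    obtain ⟨N, hN⟩ := hy
    exact ⟨M + N, filt_mul_of_add (fun m n _ _ => by omega) hM hN⟩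

theorem Gam_free (hinj : Function.Injective (ordMap K (gens p (tY K p)))) :
    Module.Free (Gam K p) (Yp K p) ∧
      ∃ N : Submodule (Gam K p) (Yp K p),
        IsCompl (Submodule.span (Gam K p) {(1 : Yp K p)}) N := by
  obtain ⟨N, m, hli, hsp, o, ho⟩ := exists_prod_basis (K := K) isRtt_tY tY_zero
    (fun _ _ _ h => tY_of_lt h) TY_eq exists_mem_filt hinj
    (h := gseq p (dY K p) (tY K p 1 1)) rfl
  refine free_and_exists_isCompl (Gam K p) _ m ?_ ?_ hli hsp ho
  · refine emon_mem_subalgebra _ fun l hl => Algebra.subset_adjoin ?_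
    unfold gseq
    split_ifs
    · exact Or.inr ⟨_, by rw [Finset.mem_Icc]; omega, rfl⟩
    · exact Or.inr ⟨_, by rw [Finset.mem_Icc]; omega, rfl⟩
    · exact Or.inl ⟨_, by rw [Finset.mem_Icc]; omega, rfl⟩
  · refine adjoin_le_span_emon gseq_commute ?_
    rintro y (⟨k, hk, rfl⟩ | ⟨i, hi, rfl⟩)
    · rw [Finset.mem_Icc] at hk
      refine ⟨2 * p + (k - 1), by omega, ?_⟩
      rw [gseq, if_neg (by omega), if_neg (by omega), show 2 * p + (k - 1) - 2 * p + 1 = k by omega]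
    · rw [Finset.mem_Icc] at hi
      rcases lt_or_ge p i with h | h
      · refine ⟨i - (p + 1), by omega, ?_⟩
        rw [gseq, if_pos (by omega), show p + 1 + (i - (p + 1)) = i by omega]
      · refine ⟨p + (i - 1), by omega, ?_⟩
        rw [gseq, if_neg (by omega), if_pos (by omega), show p + (i - 1) - p + 1 = i by omega]

end Assembly

section Coproduct

variable {S : Type*} [Ring S]

lemma rtt_step (e A B C A' B' C' : Fin 2 → Fin 2 → S)
    (cA : ∀ i j k l, e k l * A i j = A i j * e k l) (cB : ∀ i j k l, e k l * B i j = B i j * e k l)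
    (cC : ∀ i j k l, e k l * C i j = C i j * e k l)
    (cA' : ∀ i j k l, e k l * A' i j = A' i j * e k l)
    (cB' : ∀ i j k l, e k l * B' i j = B' i j * e k l)
    (cC' : ∀ i j k l, e k l * C' i j = C' i j * e k l)
    (he : ∀ i j k l, e i j * e k l - e k l * e i j =
      (if k = j then e i l else 0) - if i = l then e k j else 0)
    (h1 : ∀ i j k l, A i j * B' k l - B' k l * A i j - (B i j * A' k l - A' k l * B i j) =
      B k j * B' i l - B' k j * B i l)
    (h2 : ∀ i j k l, A i j * C' k l - C' k l * A i j - (B i j * B' k l - B' k l * B i j) =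
      B k j * C' i l - C' k j * B i l)
    (h3 : ∀ i j k l, B i j * B' k l - B' k l * B i j - (C i j * A' k l - A' k l * C i j) =
      C k j * B' i l - B' k j * C i l)
    (h4 : ∀ i j k l, B i j * C' k l - C' k l * B i j - (C i j * B' k l - B' k l * C i j) =
      C k j * C' i l - C' k j * C i l) (i j k l : Fin 2) :
    (A i j + ∑ a, B i a * e a j) * (B' k l + ∑ a, C' k a * e a l) -
      (B' k l + ∑ a, C' k a * e a l) * (A i j + ∑ a, B i a * e a j) -
      ((B i j + ∑ a, C i a * e a j) * (A' k l + ∑ a, B' k a * e a l) -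
      (A' k l + ∑ a, B' k a * e a l) * (B i j + ∑ a, C i a * e a j)) =
    (B k j + ∑ a, C k a * e a j) * (B' i l + ∑ a, C' i a * e a l) -
      (B' k j + ∑ a, C' k a * e a j) * (B i l + ∑ a, C i a * e a l) := by
  have cA₂ : ∀ i j k l x, e k l * (A i j * x) = A i j * (e k l * x) := fun i j k l x => by
    rw [← mul_assoc, cA, mul_assoc]
  have cB₂ : ∀ i j k l x, e k l * (B i j * x) = B i j * (e k l * x) := fun i j k l x => by
    rw [← mul_assoc, cB, mul_assoc]
  have cC₂ : ∀ i j k l x, e k l * (C i j * x) = C i j * (e k l * x) := fun i j k l x => by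
    rw [← mul_assoc, cC, mul_assoc]
  have cA₂' : ∀ i j k l x, e k l * (A' i j * x) = A' i j * (e k l * x) := fun i j k l x => by
    rw [← mul_assoc, cA', mul_assoc]
  have cB₂' : ∀ i j k l x, e k l * (B' i j * x) = B' i j * (e k l * x) := fun i j k l x => by
    rw [← mul_assoc, cB', mul_assoc]
  have cC₂' : ∀ i j k l x, e k l * (C' i j * x) = C' i j * (e k l * x) := fun i j k l x => by
    rw [← mul_assoc, cC', mul_assoc]
  linear_combination (norm := skip) h1 i j k l + h2 i j k 0 * e 0 l + h2 i j k 1 * e 1 l +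
    h3 i 0 k l * e 0 j + h3 i 1 k l * e 1 j +
    h4 i 0 k 0 * (e 0 j * e 0 l) + h4 i 0 k 1 * (e 0 j * e 1 l) +
    h4 i 1 k 0 * (e 1 j * e 0 l) + h4 i 1 k 1 * (e 1 j * e 1 l) +
    (C' k 0 * B i 0 - B' k 0 * C i 0) * he 0 j 0 l +
    (C' k 1 * B i 0 - B' k 1 * C i 0) * he 0 j 1 l +
    (C' k 0 * B i 1 - B' k 0 * C i 1) * he 1 j 0 l +
    (C' k 1 * B i 1 - B' k 1 * C i 1) * he 1 j 1 l
  simp only [Fin.sum_univ_two]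
  fin_cases j <;> fin_cases l <;>
  · simp only [Fin.zero_eta, Fin.mk_one, Fin.isValue, if_true, one_ne_zero, zero_ne_one, if_false,
      mul_sub, sub_mul, mul_add, add_mul, mul_assoc, cA, cB, cA', cB', cB₂, cC₂,
      cB₂', cC₂', sub_zero, zero_sub, mul_neg, mul_zero, sub_self]
    abel

/-- The family obtained by multiplying `n` degree one factors. -/
def mulFam (e : ℕ → Fin 2 → Fin 2 → S) : ℕ → Fin 2 → Fin 2 → ℕ → S
  | 0, i, j, 0 => if i = j then 1 else 0
  | 0, _, _, _ + 1 => 0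
  | n + 1, i, j, 0 => mulFam e n i j 0
  | n + 1, i, j, r + 1 => mulFam e n i j (r + 1) + ∑ a, mulFam e n i a r * e n a j

variable {e : ℕ → Fin 2 → Fin 2 → S}

lemma mulFam_zero (n : ℕ) (i j : Fin 2) : mulFam e n i j 0 = if i = j then 1 else 0 := by
  induction n with
  | zero => rfl
  | succ n ih => exact ih

lemma mulFam_of_lt (n : ℕ) (i j : Fin 2) (r : ℕ) (h : n < r) : mulFam e n i j r = 0 := by
  induction n generalizing i j r with
  | zero =>
    obtain ⟨r, rfl⟩ := Nat.exists_eq_succ_of_ne_zero (show r ≠ 0 by omega)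
    rfl
  | succ n ih =>
    obtain ⟨r, rfl⟩ := Nat.exists_eq_succ_of_ne_zero (show r ≠ 0 by omega)
    rw [mulFam, ih _ _ _ (by omega)]
    simp [ih _ _ r (by omega)]

lemma mulFam_commute
    (hc : ∀ n m, n ≠ m → ∀ i j k l, e n i j * e m k l = e m k l * e n i j) (n m : ℕ) (h : n ≤ m)
    (i j k l : Fin 2) (r : ℕ) : e m k l * mulFam e n i j r = mulFam e n i j r * e m k l := by
  induction n generalizing i j r with
  | zero =>
    cases r with
    | zero => simp only [mulFam]; split_ifs <;> simp
    | succ r => simp [mulFam]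
  | succ n ih =>
    cases r with
    | zero => exact ih (by omega) _ _ _
    | succ r =>
      rw [mulFam, mul_add, add_mul, ih (by omega), Finset.mul_sum, Finset.sum_mul]
      congr 1
      refine Finset.sum_congr rfl fun a _ => ?_
      rw [← mul_assoc, ih (by omega), mul_assoc, hc m n (by omega), mul_assoc]

lemma isRtt_mulFam
    (hc : ∀ n m, n ≠ m → ∀ i j k l, e n i j * e m k l = e m k l * e n i j)
    (he : ∀ n i j k l, e n i j * e n k l - e n k l * e n i j =
      (if k = j then e n i l else 0) - if i = l then e n k j else 0) (n : ℕ) :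
    IsRtt (mulFam e n) := by
  induction n with
  | zero =>
    rintro i j k l (_ | r) (_ | s) <;> simp [mulFam]
  | succ n ih =>
    let u : Fin 2 → Fin 2 → ℕ → S := fun i j r => Nat.casesOn r 0 fun r => mulFam e n i j r
    have hu : ∀ i j r, mulFam e (n + 1) i j r = mulFam e n i j r + ∑ a, u i a r * e n a j := by
      rintro i j (_ | r)
      · simp [u, mulFam]
      · rfl
    have cu : ∀ i j k l r, e n k l * u i j r = u i j r * e n k l := by
      rintro i j k l (_ | r)
      · simp [u]
      · exact mulFam_commute hc n n le_rfl _ _ _ _ _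
    have c0 : ∀ i j x, mulFam e n i j 0 * x = x * mulFam e n i j 0 := fun i j x => by
      rw [mulFam_zero]; split_ifs <;> simp
    intro i j k l r s
    rw [hu, hu, hu, hu, hu, hu, hu, hu]
    refine rtt_step (e n) (fun i j => mulFam e n i j (r + 1)) (fun i j => mulFam e n i j r)
      (fun i j => u i j r) (fun i j => mulFam e n i j (s + 1)) (fun i j => mulFam e n i j s)
      (fun i j => u i j s) (fun _ _ _ _ => mulFam_commute hc n n le_rfl _ _ _ _ _)
      (fun _ _ _ _ => mulFam_commute hc n n le_rfl _ _ _ _ _) (fun _ _ _ _ => cu _ _ _ _ _)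
      (fun _ _ _ _ => mulFam_commute hc n n le_rfl _ _ _ _ _)
      (fun _ _ _ _ => mulFam_commute hc n n le_rfl _ _ _ _ _) (fun _ _ _ _ => cu _ _ _ _ _)
      (he n) (fun i j k l => ih i j k l r s) (fun i j k l => ?_) (fun i j k l => ?_)
      (fun i j k l => ?_) i j k l
    · rcases s with _ | s
      · simp [u, c0]
      · exact ih i j k l r s
    · rcases r with _ | r
      · simp [u, c0]
      · exact ih i j k l r s
    · rcases r with _ | r
      · rcases s with _ | s
        · simp [u]
        · simp [u, c0]
      · rcases s with _ | s
        · simp [u, c0]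
        · exact ih i j k l r s

end Coproduct

section Generic

/-- The product of the first `n` generic matrices. -/
noncomputable def genProd (K : Type) [Field K] (n : ℕ) :
    Matrix (Fin 2) (Fin 2) (MvPolynomial (ℕ × Fin 2 × Fin 2) K) :=
  match n with
  | 0 => 1
  | n + 1 => genProd K n * Matrix.of fun i j => MvPolynomial.X (n, i, j)

variable (K : Type) [Field K] (p : ℕ)

/-- A sequence of matrices, starting with the identity and continuing with `p` independent generic
matrices. -/
noncomputable def varMat (n : ℕ) : Matrix (Fin 2) (Fin 2) (MvPolynomial (YGen p) K) :=
  if h : n ≠ 0 ∧ n ≤ p then Matrix.of fun i j => MvPolynomial.X (i, j, ⟨n - 1, by omega⟩) else 1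

lemma varMat_det_ne_zero (n : ℕ) : (varMat K p n).det ≠ 0 := by
  intro h
  have := congrArg (MvPolynomial.aeval fun g : YGen p => if g.1 = g.2.1 then (1 : K) else 0) h
  rw [varMat] at this
  split_ifs at this
  · simp [Matrix.det_fin_two] at this
  · simp at this

lemma genProd_algebraicIndependent :
    Function.Injective (MvPolynomial.aeval
      (fun g : YGen p => genProd K (g.2.2 + 1) g.1 g.2.1) :
        MvPolynomial (YGen p) K →ₐ[K] MvPolynomial (ℕ × Fin 2 × Fin 2) K) := by
  let F := FractionRing (MvPolynomial (YGen p) K)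
  let ι : MvPolynomial (YGen p) K →ₐ[K] F := IsScalarTower.toAlgHom K _ _
  have hι : Function.Injective ι := IsFractionRing.injective (MvPolynomial (YGen p) K) F
  let m : ℕ → Matrix (Fin 2) (Fin 2) F := fun n => (varMat K p n).map ι
  have hm : ∀ n, IsUnit (m n).det := fun n => by
    have : (m n).det = ι (varMat K p n).det := (AlgHom.map_det ι _).symm
    rw [this, isUnit_iff_ne_zero, map_ne_zero_iff ι hι]
    exact varMat_det_ne_zero K p n
  let φ : MvPolynomial (ℕ × Fin 2 × Fin 2) K →ₐ[K] F :=
    MvPolynomial.aeval fun g => ((m g.1)⁻¹ * m (g.1 + 1)) g.2.1 g.2.2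
  have hφ : ∀ n, (genProd K n).map φ = m n := by
    intro n
    induction n with
    | zero => simp [genProd, m, varMat, Matrix.map_one]
    | succ n ih =>
      rw [genProd, Matrix.map_mul, ih]
      have : (Matrix.of fun i j => (MvPolynomial.X (n, i, j) :
          MvPolynomial (ℕ × Fin 2 × Fin 2) K)).map φ = (m n)⁻¹ * m (n + 1) := by
        ext i j
        simp [φ]
      rw [this, Matrix.mul_nonsing_inv_cancel_left _ _ (hm n)]
  have key : φ.comp (MvPolynomial.aeval (fun g : YGen p => genProd K (g.2.2 + 1) g.1 g.2.1)) =
      ι := by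
    apply MvPolynomial.algHom_ext
    rintro ⟨i, j, k⟩
    have h1 := congrFun (congrFun (hφ (k + 1)) i) j
    have h2 : varMat K p (k + 1) i j = MvPolynomial.X (i, j, k) := by
      rw [varMat, dif_pos ⟨by omega, by omega⟩]
      rfl
    simp only [Matrix.map_apply, m, h2] at h1
    simpa using h1
  apply Function.Injective.of_comp (f := φ)
  rw [← AlgHom.coe_comp, key]
  exact hι

end Generic

section Operators

variable (K : Type) [Field K]

/-- The polynomial ring in the entries of a sequence of generic matrices. -/
abbrev GenRing := MvPolynomial (ℕ × Fin 2 × Fin 2) K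

/-- The polarization operator `∑ₗ y_{il} ∂/∂y_{jl}` in the entries of the `s`-th matrix. -/
noncomputable def polar (s : ℕ) (i j : Fin 2) : Derivation K (GenRing K) (GenRing K) :=
  MvPolynomial.mkDerivation K fun g =>
    if g.1 = s ∧ g.2.1 = j then MvPolynomial.X (s, i, g.2.2) else 0

lemma polar_X (s : ℕ) (i j : Fin 2) (s' : ℕ) (k l : Fin 2) :
    polar K s i j (MvPolynomial.X (s', k, l)) =
      if s' = s ∧ k = j then MvPolynomial.X (s, i, l) else 0 := by
  rw [polar, MvPolynomial.mkDerivation_X]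

lemma polar_comm (s s' : ℕ) (i j k l : Fin 2) :
    ⁅polar K s i j, polar K s' k l⁆ =
      if s = s' then (if k = j then polar K s i l else 0) - (if i = l then polar K s k j else 0)
      else 0 := by
  apply MvPolynomial.derivation_ext
  rintro ⟨n, a, b⟩
  rw [Derivation.commutator_apply, polar_X, polar_X]
  by_cases hs : s = s'
  · subst hs
    rw [if_pos rfl]
    by_cases hn : n = s
    · subst hn
      rw [Derivation.sub_apply]
      split_ifs <;> simp_all [polar_X]
    · simp only [hn, false_and, if_false, map_zero, sub_self]
      split_ifs <;> simp [polar_X, hn]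
  · rw [if_neg hs]
    by_cases hn : n = s
    · subst hn
      split_ifs <;> simp_all [polar_X]
    · split_ifs <;> simp_all [polar_X, eq_comm]

/-- The operator of multiplication by an element. -/
noncomputable abbrev mulOp : GenRing K →ₐ[K] Module.End K (GenRing K) := Algebra.lmul K (GenRing K)

/-- The polarization operator as an endomorphism. -/
noncomputable def polarOp (s : ℕ) (i j : Fin 2) : Module.End K (GenRing K) :=
  (polar K s i j : GenRing K →ₗ[K] GenRing K)

lemma polarOp_comm (s s' : ℕ) (i j k l : Fin 2) :
    polarOp K s i j * polarOp K s' k l - polarOp K s' k l * polarOp K s i j =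
      if s = s' then (if k = j then polarOp K s i l else 0) -
        (if i = l then polarOp K s k j else 0)
      else 0 := by
  refine LinearMap.ext fun f => ?_
  have := congrArg (fun D : Derivation K (GenRing K) (GenRing K) => D f)
    (polar_comm K s s' i j k l)
  simp only [Derivation.commutator_apply] at this
  simp only [polarOp]
  refine this.trans ?_
  split_ifs <;> simp

lemma polarOp_mulOp (s s' : ℕ) (i j k l : Fin 2) :
    polarOp K s i j * mulOp K (MvPolynomial.X (s', k, l)) -
      mulOp K (MvPolynomial.X (s', k, l)) * polarOp K s i j =
      if s' = s ∧ k = j then mulOp K (MvPolynomial.X (s, i, l)) else 0 := by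
  refine LinearMap.ext fun f => ?_
  have h := (polar K s i j).leibniz (MvPolynomial.X (s', k, l)) f
  rw [polar_X] at h
  simp only [LinearMap.sub_apply, Module.End.mul_apply, polarOp,
    Algebra.coe_lmul_eq_mul, LinearMap.mul_apply', Derivation.coeFn_coe, h]
  split_ifs <;> simp [mul_comm]

end Operators

section Oscillator

variable {R : Type*} [Ring R] (a b : ℕ → Fin 2 → Fin 2 → R)

/-- A degree one factor of the oscillator representation, with leading coefficient in degree `d`. -/
noncomputable def osc (d : ℕ → ℕ) (s : ℕ) (i j : Fin 2) : R[X] :=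
  C (a s i j) * X ^ d s + C (b s i j)

variable {a b}

lemma osc_comm (haa : ∀ s s' i j k l, a s i j * a s' k l = a s' k l * a s i j)
    (hba : ∀ s s' i j k l, b s i j * a s' k l - a s' k l * b s i j =
      if s' = s ∧ k = j then a s i l else 0)
    (hbb : ∀ s s' i j k l, b s i j * b s' k l - b s' k l * b s i j =
      if s = s' then (if k = j then b s i l else 0) - (if i = l then b s k j else 0) else 0)
    (d : ℕ → ℕ) (s s' : ℕ) (i j k l : Fin 2) :
    osc a b d s i j * osc a b d s' k l - osc a b d s' k l * osc a b d s i j =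
      if s = s' then (if k = j then osc a b d s i l else 0) -
        (if i = l then osc a b d s k j else 0)
      else 0 := by
  have e : ∀ a b a' b' : R, ∀ m n : ℕ,
      (C a * X ^ m + C b) * (C a' * X ^ n + C b') - (C a' * X ^ n + C b') * (C a * X ^ m + C b) =
      C (a * a' - a' * a) * X ^ (m + n) + C (b * a' - a' * b) * X ^ n -
        C (b' * a - a * b') * X ^ m + C (b * b' - b' * b) := by
    intro a b a' b' m n
    have h1 : ∀ (c : R) (f : R[X]) (m : ℕ), X ^ m * (C c * f) = C c * (X ^ m * f) :=
      fun c f m => by rw [← mul_assoc, X_pow_mul_C, mul_assoc]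
    simp only [add_mul, mul_add, map_sub, map_mul, sub_mul, mul_assoc, h1, X_pow_mul_C, ← pow_add,
      add_comm n m]
    abel
  rw [osc, osc, e, hba, hba, hbb, haa s s', sub_self, map_zero, zero_mul, zero_add]
  by_cases hs : s = s'
  · subst hs
    simp only [true_and, if_true]
    split_ifs <;> simp only [osc, map_sub, map_zero, zero_mul, sub_zero, zero_sub, map_neg] <;> abel
  · simp [hs, Ne.symm hs]

end Oscillator

section Leading

variable {K : Type*} [Field K] {R Q : Type*} [Ring R] [Algebra K R]

lemma linearIndependent_of_coeff [AddCommGroup Q] [Module K Q] {L : Q →ₗ[K] R}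
    (hL : Function.Injective L) {ι : Type*} {x : ι → R[X]} {n : ι → ℕ} {f : ι → Q}
    (hd : ∀ i, (x i).natDegree ≤ n i) (hx : ∀ i, (x i).coeff (n i) = L (f i))
    (hf : LinearIndependent K f) : LinearIndependent K x := by
  classical
  rw [linearIndependent_iff']
  intro s c hs
  by_contra! hne
  obtain ⟨i₀, hi₀, hci₀⟩ := hne
  obtain ⟨j, hj, hmax⟩ := Finset.exists_max_image (s.filter fun i => c i ≠ 0) n
    ⟨i₀, by simp [hi₀, hci₀]⟩
  rw [Finset.mem_filter] at hj
  have h1 : L (∑ i ∈ s, (if n i = n j then c i else 0) • f i) = 0 := by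
    have := congrArg (fun q => coeff q (n j)) hs
    simp only [finsetSum_coeff, coeff_smul, coeff_zero] at this
    rw [← this, map_sum]
    refine Finset.sum_congr rfl fun i hi => ?_
    split_ifs with hij
    · rw [map_smul, ← hx, hij]
    · by_cases hc0 : c i = 0
      · simp [hc0]
      · have : n i < n j := lt_of_le_of_ne (hmax i (by simp [hi, hc0])) hij
        rw [coeff_eq_zero_of_natDegree_lt ((hd i).trans_lt this)]
        simp
  have h2 := linearIndependent_iff'.1 hf s _ (hL (h1.trans (map_zero L).symm)) j hj.1
  simp only [if_true] at h2
  exact hj.2 h2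

lemma list_prod_coeff [Ring Q] {L : Q →+* R} {G : Type*} {x : G → R[X]} {n : G → ℕ} {f : G → Q}
    (hd : ∀ i, (x i).natDegree ≤ n i) (hx : ∀ i, (x i).coeff (n i) = L (f i)) (l : List G) :
    (l.map x).prod.natDegree ≤ (l.map n).sum ∧
      (l.map x).prod.coeff (l.map n).sum = L (l.map f).prod := by
  induction l with
  | nil => simp
  | cons g l ih =>
    simp only [List.map_cons, List.prod_cons, List.sum_cons]
    refine ⟨natDegree_mul_le_of_le (hd g) ih.1, ?_⟩
    rw [coeff_mul_add_eq_of_natDegree_le (hd g) ih.1, hx, ih.2, map_mul]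

lemma ordMap_injective_of_coeff [CommRing Q] [Algebra K Q] {Y : Type*} [Ring Y] [Algebra K Y]
    {G : Type*} {t : G → Y} (ρ : Y →ₐ[K] R[X]) {L : Q →ₐ[K] R} (hL : Function.Injective L)
    {n : G → ℕ} {f : G → Q}
    (hd : ∀ g, (ρ (t g)).natDegree ≤ n g) (hx : ∀ g, (ρ (t g)).coeff (n g) = L (f g))
    (hf : Function.Injective (MvPolynomial.aeval f : MvPolynomial G K →ₐ[K] Q)) :
    Function.Injective (ordMap K t) := by
  classical
  have hli : LinearIndependent K fun e : G →₀ ℕ =>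
      ρ (ordMap K t (MvPolynomial.monomial e 1)) := by
    refine linearIndependent_of_coeff (L := L.toLinearMap) hL
      (n := fun e => ((Finsupp.toMultiset e).toList.map n).sum)
      (f := fun e => MvPolynomial.aeval f (MvPolynomial.monomial e (1 : K)))
      (fun e => ?_) (fun e => ?_) ?_
    · rw [ordMap_monomial, map_list_prod, List.map_map]
      exact (list_prod_coeff (L := (L : Q →+* R)) hd hx _).1
    · rw [ordMap_monomial, map_list_prod, List.map_map]
      refine (list_prod_coeff (L := (L : Q →+* R)) hd hx _).2.trans ?_
      have h := list_prod_X (K := K) (Finsupp.toMultiset e).toList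
      rw [Multiset.coe_toList, Finsupp.toMultiset_toFinsupp] at h
      have hX : ⇑(MvPolynomial.aeval f : MvPolynomial G K →ₐ[K] Q) ∘ MvPolynomial.X = f :=
        funext fun g => MvPolynomial.aeval_X _ _
      rw [← h, map_list_prod (MvPolynomial.aeval f : MvPolynomial G K →ₐ[K] Q), List.map_map, hX]
      rfl
    · have := (MvPolynomial.basisMonomials G K).linearIndependent.map'
        (MvPolynomial.aeval f : MvPolynomial G K →ₐ[K] Q).toLinearMap
        (LinearMap.ker_eq_bot.2 hf)
      simpa [Function.comp_def] using this
  have h2 : Function.Injective (ρ.toLinearMap ∘ₗ ordMap K t) := by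
    rw [← LinearMap.ker_eq_bot, LinearMap.ker_eq_bot']
    intro q hq
    rw [← (MvPolynomial.basisMonomials G K).linearCombination_repr q,
      Finsupp.apply_linearCombination] at hq
    have h4 : ⇑(ρ.toLinearMap ∘ₗ ordMap K t) ∘ ⇑(MvPolynomial.basisMonomials G K) =
        fun e : G →₀ ℕ => ρ (ordMap K t (MvPolynomial.monomial e 1)) := by
      ext e; simp
    rw [h4] at hq
    have h5 := linearIndependent_iff.1 hli _ hq
    simpa using h5
  exact Function.Injective.of_comp (f := ρ.toLinearMap) h2

variable {a b : ℕ → Fin 2 → Fin 2 → R} {d : ℕ → ℕ}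

lemma natDegree_osc (s : ℕ) (i j : Fin 2) : (osc a b d s i j).natDegree ≤ d s :=
  natDegree_add_le_of_degree_le (natDegree_C_mul_X_pow_le _ _) (by simp)

lemma coeff_osc (s : ℕ) (i j : Fin 2) (h : 0 < d s) :
    (osc a b d s i j).coeff (d s) = a s i j := by
  simp [osc, coeff_C, h.ne']

end Leading

section Injectivity

variable {K : Type} [Field K] {p : ℕ} {R : Type*} [Ring R] [Algebra K R]

lemma mulFam_osc_coeff {b : ℕ → Fin 2 → Fin 2 → R} (L : GenRing K →ₐ[K] R) (n : ℕ) (hn : n ≤ p)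
    (i j : Fin 2) (k : ℕ) :
    (mulFam (osc (fun s i j => L (MvPolynomial.X (s, i, j))) b (p - ·)) n i j k).natDegree ≤
      ∑ s ∈ Finset.range k, (p - s) ∧
    (k ≤ n → (mulFam (osc (fun s i j => L (MvPolynomial.X (s, i, j))) b (p - ·)) n i j k).coeff
      (∑ s ∈ Finset.range k, (p - s)) = L (genProd K k i j)) := by
  set e := osc (fun s i j => L (MvPolynomial.X (s, i, j))) b (p - ·) with he
  induction n generalizing i j k with
  | zero =>
    cases k with
    | zero => rw [mulFam_zero]; split_ifs with h <;> simp [genProd, Matrix.one_apply, h]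
    | succ k => rw [mulFam_of_lt _ _ _ _ (by omega)]; simp
  | succ n ih =>
    cases k with
    | zero => exact ⟨(ih (by omega) i j 0).1, fun _ => (ih (by omega) i j 0).2 (by omega)⟩
    | succ k =>
      rcases lt_or_ge n k with hk | hk
      · rw [mulFam_of_lt _ _ _ _ (by omega)]
        exact ⟨by simp, fun h => by omega⟩
      have h1 : ∀ c, (mulFam e n i c k * e n c j).natDegree ≤
          (∑ s ∈ Finset.range k, (p - s)) + (p - n) := fun c =>
        natDegree_mul_le_of_le (ih (by omega) i c k).1 (natDegree_osc _ _ _)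
      rw [mulFam, Finset.sum_range_succ]
      refine ⟨natDegree_add_le_of_degree_le ?_ (natDegree_sum_le_of_forall_le _ _ fun c _ =>
        (h1 c).trans (by omega)), fun _ => ?_⟩
      · rw [← Finset.sum_range_succ]
        exact (ih (by omega) i j (k + 1)).1
      · rw [coeff_add, finsetSum_coeff]
        rcases hk.lt_or_eq with hk | rfl
        · rw [← Finset.sum_range_succ, (ih (by omega) i j (k + 1)).2 (by omega),
            Finset.sum_eq_zero, add_zero]
          intro c _
          apply coeff_eq_zero_of_natDegree_lt
          refine (h1 c).trans_lt ?_
          rw [Finset.sum_range_succ]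
          omega
        · rw [mulFam_of_lt _ _ _ _ (by omega), coeff_zero, zero_add, genProd, Matrix.mul_apply,
            map_sum]
          refine Finset.sum_congr rfl fun c _ => ?_
          rw [coeff_mul_add_eq_of_natDegree_le (ih (by omega) i c k).1 (natDegree_osc _ _ _),
            (ih (by omega) i c k).2 le_rfl, coeff_osc _ _ _ (by omega), map_mul]
          rfl

theorem ordMap_injective (K : Type) [Field K] (p : ℕ) :
    Function.Injective (ordMap K (gens p (tY K p))) := by
  let e := osc (fun s i j => mulOp K (MvPolynomial.X (s, i, j))) (polarOp K) (p - ·)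
  have hcomm := osc_comm (a := fun s i j => mulOp K (MvPolynomial.X (s, i, j))) (b := polarOp K)
    (fun s s' i j k l => by rw [← map_mul, mul_comm, map_mul])
    (fun s s' i j k l => polarOp_mulOp K s s' i j k l)
    (fun s s' i j k l => polarOp_comm K s s' i j k l) (p - ·)
  have hrtt : IsRtt (mulFam e p) := by
    apply isRtt_mulFam
    · intro n m h i j k l
      have := hcomm n m i j k l
      rw [if_neg h] at this
      exact sub_eq_zero.1 this
    · intro n i j k l
      have := hcomm n n i j k l
      rwa [if_pos rfl] at this
  let ρ : Yp K p →ₐ[K] (Module.End K (GenRing K))[X] :=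
    ofRtt (mulFam e p) hrtt (mulFam_zero p) (mulFam_of_lt p)
  have hρ : ∀ g, ρ (gens p (tY K p) g) = mulFam e p g.1 g.2.1 (g.2.2 + 1) := fun g =>
    ofRtt_tY _ hrtt (mulFam_zero p) (mulFam_of_lt p) _ _ _
  refine ordMap_injective_of_coeff ρ (L := mulOp K) Algebra.lmul_injective
    (n := fun g => ∑ s ∈ Finset.range (g.2.2 + 1), (p - s)) (fun g => ?_) (fun g => ?_)
    (genProd_algebraicIndependent K p)
  · rw [hρ]
    exact (mulFam_osc_coeff (mulOp K) p le_rfl _ _ _).1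
  · rw [hρ]
    exact (mulFam_osc_coeff (mulOp K) p le_rfl _ _ _).2 (by omega)

end Injectivity

end LevelYangian

/-- `Y_p(gl_2)` is a free left module over the subalgebra `Γ` generated by the
`t_22^(k)` and the quantum determinant coefficients `d_i`, and `Γ` is a direct
summand of `Y_p(gl_2)` as a `Γ`-module. -/
theorem Yp_free_over_Gamma (K : Type) [Field K] (p : ℕ) :
    Module.Free (Gam K p) (Yp K p) ∧
      ∃ N : Submodule (Gam K p) (Yp K p),
        IsCompl (Submodule.span (Gam K p) {(1 : Yp K p)}) N :=
  LevelYangian.Gam_free (LevelYangian.ordMap_injective K p)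
end

section
/- The map t_{ij}^{(r)} ↦ t_{ji}^{(r)} extends to an anti-automorphism of the level-p Yangian Y_p(gl_2), and every element of the subalgebra Γ (generated by the t_{22}^{(k)} and the quantum determinant coefficients d_i) is fixed by this anti-automorphism. -/
open Polynomial

section LevelPolynomial

variable {A B : Type*} [Ring A] [Ring B]

/-- The value `Σ_{k=0}^p t_k α^{p-k}` at `α` of the level-`p` polynomial with coefficients `t`,
computed in `B` through `ι : A → B`. -/
noncomputable def levelEval (ι : A →+* B) (p : ℕ) (t : ℕ → A) (α : B) : B :=
  ∑ k ∈ Finset.range (p + 1), ι (t k) * α ^ (p - k)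

theorem levelEval_C_X_comp (p : ℕ) (t : ℕ → A) (q : A[X]) :
    (levelEval C p t X).comp q = levelEval C p t q := by
  simp [levelEval]

theorem map_levelEval {B' : Type*} [Ring B'] (f : B →+* B') (ι : A →+* B) (p : ℕ) (t : ℕ → A)
    (α : B) : f (levelEval ι p t α) = levelEval (f.comp ι) p t (f α) := by
  simp [levelEval]

theorem commute_X_sub_one (P : A[X]) : Commute (X - 1) P :=
  (commute_X P).sub_left (Commute.one_left P)

theorem commute_C_of_forall_commute {α : A} (hα : ∀ a, Commute α a) (P : A[X]) :
    Commute (C α) P := by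
  refine Polynomial.ext fun n => ?_
  rw [coeff_C_mul, coeff_mul_C, (hα _).eq]

/-- The map `A[X] → A[X]ᵐᵒᵖ` applying `φ : A → Aᵐᵒᵖ` to the coefficients. -/
noncomputable def mapOpPoly (φ : A →+* Aᵐᵒᵖ) : A[X] →+* A[X]ᵐᵒᵖ :=
  (opRingEquiv A).symm.toRingHom.comp (mapRingHom φ)

theorem coeff_unop_mapOpPoly (φ : A →+* Aᵐᵒᵖ) (P : A[X]) (n : ℕ) :
    (mapOpPoly φ P).unop.coeff n = (φ (P.coeff n)).unop := by
  rw [← MulOpposite.op_inj, MulOpposite.op_unop, ← coeff_opRingEquiv]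
  simp [mapOpPoly]

theorem mapOpPoly_C (φ : A →+* Aᵐᵒᵖ) (a : A) :
    mapOpPoly φ (C a) = MulOpposite.op (C (φ a).unop) := by
  simp [mapOpPoly]

theorem mapOpPoly_X (φ : A →+* Aᵐᵒᵖ) : mapOpPoly φ X = MulOpposite.op X := by
  simp [mapOpPoly]

theorem mapOpPoly_levelEval (φ : A →+* Aᵐᵒᵖ) (p : ℕ) {t t' : ℕ → A} {q : A[X]}
    (h : ∀ r, φ (t r) = MulOpposite.op (t' r)) (hq : ∀ P, Commute q P)
    (hφq : mapOpPoly φ q = MulOpposite.op q) :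
    mapOpPoly φ (levelEval C p t q) = MulOpposite.op (levelEval C p t' q) := by
  simp only [levelEval, Finset.op_sum, map_sum, map_mul, map_pow, mapOpPoly_C, hφq, h,
    MulOpposite.unop_op]
  refine Finset.sum_congr rfl fun k _ => ?_
  rw [← ((hq _).pow_left _).eq, MulOpposite.op_mul, MulOpposite.op_pow]

/-- Shift of the summation index against decreasing powers. -/
theorem sum_range_succ_mul_pow (f : ℕ → B) (n : ℕ) (u : B)
    (h0 : f 0 = 0) (hn : f (n + 1) = 0) :
    ∑ r ∈ Finset.range (n + 1), f (r + 1) * u ^ (n - r) =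
      (∑ r ∈ Finset.range (n + 1), f r * u ^ (n - r)) * u := by
  have h := Finset.sum_range_succ' (fun r => f r * u ^ (n + 1 - r)) (n + 1)
  rw [Finset.sum_range_succ, h0, hn] at h
  simp only [zero_mul, add_zero, Nat.add_sub_add_right] at h
  rw [← h, Finset.sum_mul]
  refine Finset.sum_congr rfl fun r hr => ?_
  rw [mul_assoc, ← pow_succ, Nat.sub_add_comm (Finset.mem_range_succ_iff.1 hr)]

theorem levelEval_mul_levelEval (ι : A →+* B) (p : ℕ) (t t' : ℕ → A) {α : B} (β : B)
    (hα : ∀ x, Commute α x) :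
    levelEval ι p t α * levelEval ι p t' β =
      ∑ r ∈ Finset.range (p + 1), ∑ s ∈ Finset.range (p + 1),
        ι (t r * t' s) * α ^ (p - r) * β ^ (p - s) := by
  rw [levelEval, levelEval, Finset.sum_mul_sum]
  refine Finset.sum_congr rfl fun r _ => Finset.sum_congr rfl fun s _ => ?_
  rw [map_mul, mul_assoc, mul_assoc, mul_assoc, ← mul_assoc (α ^ _), ((hα _).pow_left _).eq,
    mul_assoc, ((hα _).pow_left _).eq]

theorem levelEval_mul_levelEval_swap (ι : A →+* B) (p : ℕ) (t t' : ℕ → A) (α : B) {β : B}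
    (hβ : ∀ x, Commute β x) :
    levelEval ι p t' β * levelEval ι p t α =
      ∑ r ∈ Finset.range (p + 1), ∑ s ∈ Finset.range (p + 1),
        ι (t' s * t r) * α ^ (p - r) * β ^ (p - s) := by
  rw [levelEval_mul_levelEval ι p t' t α hβ, Finset.sum_comm]
  refine Finset.sum_congr rfl fun r _ => Finset.sum_congr rfl fun s _ => ?_
  rw [mul_assoc, mul_assoc, ((hβ _).pow_left _).eq]

/-- If the commutators of two sequences satisfy the Yangian recursion, then their generating
polynomials satisfy the corresponding relation at any two central points. -/
theorem levelEval_commutator (ι : A →+* B) (p : ℕ) {a b c d : ℕ → A} {α β : B}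
    (hα : ∀ x, Commute α x) (hβ : ∀ x, Commute β x)
    (ha0 : ∀ x, Commute (a 0) x) (hap : a (p + 1) = 0)
    (hb0 : ∀ x, Commute (b 0) x) (hbp : b (p + 1) = 0)
    (h : ∀ r s, (a (r + 1) * b s - b s * a (r + 1)) - (a r * b (s + 1) - b (s + 1) * a r) =
      c r * d s - c s * d r) :
    (α - β) * (levelEval ι p a α * levelEval ι p b β - levelEval ι p b β * levelEval ι p a α) =
      levelEval ι p c α * levelEval ι p d β - levelEval ι p c β * levelEval ι p d α := by
  let e : ℕ → ℕ → B := fun r s => ι (a r * b s - b s * a r)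
  have he0 : ∀ s, e 0 s = 0 := fun s => by simp only [e, (ha0 _).eq, sub_self, map_zero]
  have he0' : ∀ r, e r 0 = 0 := fun r => by simp only [e, (hb0 _).eq, sub_self, map_zero]
  have hep : ∀ s, e (p + 1) s = 0 := fun s => by simp [e, hap]
  have hep' : ∀ r, e r (p + 1) = 0 := fun r => by simp [e, hbp]
  let S := ∑ r ∈ Finset.range (p + 1), ∑ s ∈ Finset.range (p + 1),
    e r s * α ^ (p - r) * β ^ (p - s)
  have hleft : ∑ r ∈ Finset.range (p + 1), ∑ s ∈ Finset.range (p + 1),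
      e (r + 1) s * α ^ (p - r) * β ^ (p - s) = S * α := by
    have hcomm : ∀ x : B, ∀ m n : ℕ, x * α ^ m * β ^ n = x * β ^ n * α ^ m := fun x m n => by
      rw [mul_assoc, mul_assoc, ((hα _).pow_left _).eq]
    simp only [S, hcomm, ← Finset.sum_mul]
    exact sum_range_succ_mul_pow
      (fun r => ∑ s ∈ Finset.range (p + 1), e r s * β ^ (p - s)) p α
      (by simp [he0]) (by simp [hep])
  have hright : ∑ r ∈ Finset.range (p + 1), ∑ s ∈ Finset.range (p + 1),
      e r (s + 1) * α ^ (p - r) * β ^ (p - s) = S * β := by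
    simp only [S]
    rw [Finset.sum_mul]
    refine Finset.sum_congr rfl fun r _ => ?_
    exact sum_range_succ_mul_pow (fun s => e r s * α ^ (p - r)) p β
      (by simp [he0']) (by simp [hep'])
  calc
    _ = (α - β) * S := by
      simp only [S, e, levelEval_mul_levelEval ι p a b β hα,
        levelEval_mul_levelEval_swap ι p a b α hβ, map_sub, sub_mul, Finset.sum_sub_distrib]
    _ = S * α - S * β := by rw [sub_mul, (hα S).eq, (hβ S).eq]
    _ = _ := by
      rw [← hleft, ← hright]
      simp only [levelEval_mul_levelEval ι p c d β hα, levelEval_mul_levelEval_swap ι p d c α hβ,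
        ← Finset.sum_sub_distrib, ← sub_mul, e, ← map_sub, h]

/-- The coefficients of the quantum determinant are fixed by an anti-endomorphism that transposes
the entries. -/
theorem map_coeff_qdet (φ : A →+* Aᵐᵒᵖ) (p : ℕ) {a b c d : ℕ → A}
    (ha : ∀ r, φ (a r) = MulOpposite.op (a r)) (hb : ∀ r, φ (b r) = MulOpposite.op (b r))
    (hc : ∀ r, φ (c r) = MulOpposite.op (d r)) (hd : ∀ r, φ (d r) = MulOpposite.op (c r))
    (ha0 : ∀ x, Commute (a 0) x) (hap : a (p + 1) = 0)
    (hb0 : ∀ x, Commute (b 0) x) (hbp : b (p + 1) = 0)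
    (h : ∀ r s, (a (r + 1) * b s - b s * a (r + 1)) - (a r * b (s + 1) - b (s + 1) * a r) =
      c r * d s - c s * d r) (n : ℕ) :
    φ ((levelEval C p a X * levelEval C p b (X - 1) -
        levelEval C p c X * levelEval C p d (X - 1)).coeff n) =
      MulOpposite.op ((levelEval C p a X * levelEval C p b (X - 1) -
        levelEval C p c X * levelEval C p d (X - 1)).coeff n) := by
  have hφX : mapOpPoly φ (X - 1) = MulOpposite.op (X - 1) := by
    rw [map_sub, mapOpPoly_X, map_one, MulOpposite.op_sub, MulOpposite.op_one]
  have key := levelEval_commutator C p commute_X commute_X_sub_one ha0 hap hb0 hbp h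
  rw [sub_sub_cancel, one_mul, sub_eq_sub_iff_add_eq_add] at key
  rw [← MulOpposite.unop_inj, ← coeff_unop_mapOpPoly, map_sub, map_mul, map_mul,
    mapOpPoly_levelEval φ p ha commute_X (mapOpPoly_X φ),
    mapOpPoly_levelEval φ p hb commute_X_sub_one hφX,
    mapOpPoly_levelEval φ p hc commute_X (mapOpPoly_X φ),
    mapOpPoly_levelEval φ p hd commute_X_sub_one hφX, ← MulOpposite.op_mul,
    ← MulOpposite.op_mul, ← MulOpposite.op_sub, MulOpposite.unop_op, MulOpposite.unop_op]
  congr 1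
  rw [sub_eq_sub_iff_add_eq_add, eq_comm, key, add_comm]

theorem smul_commutator_qdet_left {R : Type*} [CommRing R] [Algebra R B]
    (P Q V : Fin 2 → Fin 2 → B) (x : R)
    (hQP : ∀ i j k l, (-x) • (Q i j * P k l - P k l * Q i j) = Q k j * P i l - P k j * Q i l)
    (hPV : ∀ i j k l, (x + 1) • (P i j * V k l - V k l * P i j) = P k j * V i l - V k j * P i l)
    (hQV : ∀ i j k l, Q i j * V k l - V k l * Q i j = Q k j * V i l - V k j * Q i l) (i : Fin 2) :
    (x + 1) • (P i 0 * (Q 0 0 * V 1 1 - Q 1 0 * V 0 1) -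
      (Q 0 0 * V 1 1 - Q 1 0 * V 0 1) * P i 0) = 0 := by
  have h1 := congrArg (· * V 1 1) (hQP 0 0 i 0)
  have h2 := congrArg (Q 0 0 * ·) (hPV i 0 1 1)
  have h3 := congrArg (Q 1 0 * ·) (hPV i 0 0 1)
  have h4 := congrArg (· * V 0 1) (hQP 1 0 i 0)
  have h5 := congrArg (· * P i 1) (hQV 1 0 0 0)
  simp only [mul_sub, sub_mul, mul_assoc, smul_mul_assoc, mul_smul_comm] at h1 h2 h3 h4 h5 ⊢
  fin_cases i <;> simp only [Fin.zero_eta, Fin.mk_one] at h1 h2 h3 h4 h5 ⊢ <;>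
    linear_combination (norm := module) h1 + h2 - h3 - h4 + h5

theorem smul_commutator_qdet_right {R : Type*} [CommRing R] [Algebra R B]
    (P Q V : Fin 2 → Fin 2 → B) (x : R)
    (hQP : ∀ i j k l, (-x) • (Q i j * P k l - P k l * Q i j) = Q k j * P i l - P k j * Q i l)
    (hPV : ∀ i j k l, (x + 1) • (P i j * V k l - V k l * P i j) = P k j * V i l - V k j * P i l)
    (hQV : ∀ i j k l, Q i j * V k l - V k l * Q i j = Q k j * V i l - V k j * Q i l) (i : Fin 2) :
    x • (P i 1 * (Q 0 0 * V 1 1 - Q 1 0 * V 0 1) -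
      (Q 0 0 * V 1 1 - Q 1 0 * V 0 1) * P i 1) = 0 := by
  have h1 := congrArg (P i 0 * ·) (hQV 0 1 1 1)
  have h2 := congrArg (· * V 1 1) (hQP 0 0 i 1)
  have h3 := congrArg (· * V 0 1) (hQP 1 0 i 1)
  have h4 := congrArg (Q 1 0 * ·) (hPV i 1 0 1)
  have h5 := congrArg (Q 0 0 * ·) (hPV i 1 1 1)
  simp only [mul_sub, sub_mul, mul_assoc, smul_mul_assoc, mul_smul_comm] at h1 h2 h3 h4 h5 ⊢
  fin_cases i <;> simp only [Fin.zero_eta, Fin.mk_one] at h1 h2 h3 h4 h5 ⊢ <;>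
    linear_combination (norm := module) -h1 + h2 - h3 - h4 + h5

/-- The quantum determinant commutes with the coefficients of all the entries. -/
theorem commute_coeff_qdet (p : ℕ) (t : Fin 2 → Fin 2 → ℕ → A)
    (h0 : ∀ i j x, Commute (t i j 0) x) (hp : ∀ i j, t i j (p + 1) = 0)
    (h : ∀ i j k l r s,
      (t i j (r + 1) * t k l s - t k l s * t i j (r + 1)) -
        (t i j r * t k l (s + 1) - t k l (s + 1) * t i j r) =
      t k j r * t i l s - t k j s * t i l r)
    (i j : Fin 2) {r : ℕ} (hr : r ≤ p) (n : ℕ) :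
    Commute (t i j r) ((levelEval C p (t 0 0) X * levelEval C p (t 1 1) (X - 1) -
        levelEval C p (t 1 0) X * levelEval C p (t 0 1) (X - 1)).coeff n) := by
  set D := levelEval C p (t 0 0) X * levelEval C p (t 1 1) (X - 1) -
    levelEval C p (t 1 0) X * levelEval C p (t 0 1) (X - 1) with hD
  let ι : A →+* A[X][X] := C.comp C
  let T : A[X][X] → Fin 2 → Fin 2 → A[X][X] := fun α i j => levelEval ι p (t i j) α
  have hrel : ∀ {α β : A[X][X]}, (∀ x, Commute α x) → (∀ x, Commute β x) → ∀ i j k l,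
      (α - β) * (T α i j * T β k l - T β k l * T α i j) =
        T α k j * T β i l - T β k j * T α i l := fun hα hβ i j k l =>
    levelEval_commutator ι p hα hβ (h0 i j) (hp i j) (h0 k l) (hp k l) (h i j k l)
  have hu : ∀ x, Commute (C X : A[X][X]) x := commute_C_of_forall_commute commute_X
  have hv : ∀ x, Commute (C (X - 1) : A[X][X]) x := commute_C_of_forall_commute commute_X_sub_one
  have hDT : C D = T (C X) 0 0 * T (C (X - 1)) 1 1 - T (C X) 1 0 * T (C (X - 1)) 0 1 := by
    simp only [hD, map_sub C (_ * _), map_mul, map_levelEval, T, ι]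
  let x : Subring.center A[X][X] :=
    ⟨X - C X, Subring.mem_center_iff.2 fun y => ((commute_X y).sub_left (hu y)).eq.symm⟩
  have hx : ((x + 1 : Subring.center A[X][X]) : A[X][X]) = X - C (X - 1) := by
    simp [x]
    abel
  have hQP : ∀ i j k l, (-x) • (T (C X) i j * T X k l - T X k l * T (C X) i j) =
      T (C X) k j * T X i l - T X k j * T (C X) i l := fun i j k l => by
    rw [← hrel hu commute_X, Subring.smul_def, smul_eq_mul]
    simp [x]
  have hPV : ∀ i j k l,
      (x + 1) • (T X i j * T (C (X - 1)) k l - T (C (X - 1)) k l * T X i j) =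
        T X k j * T (C (X - 1)) i l - T (C (X - 1)) k j * T X i l := fun i j k l => by
    rw [← hrel commute_X hv, Subring.smul_def, smul_eq_mul, hx]
  have hQV : ∀ i j k l, T (C X) i j * T (C (X - 1)) k l - T (C (X - 1)) k l * T (C X) i j =
      T (C X) k j * T (C (X - 1)) i l - T (C (X - 1)) k j * T (C X) i l := fun i j k l => by
    rw [← hrel hu hv, ← C_sub, sub_sub_cancel, C_1, one_mul]
  have hcomm : T X i j * C D - C D * T X i j = 0 := by
    rw [hDT]
    fin_cases j
    · refine (monic_X_sub_C (X - 1 : A[X])).mul_right_eq_zero_iff.1 ?_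
      rw [← hx, ← smul_eq_mul, ← Subring.smul_def]
      exact smul_commutator_qdet_left _ _ _ x hQP hPV hQV i
    · exact (monic_X_sub_C (X : A[X])).mul_right_eq_zero_iff.1
        (smul_commutator_qdet_right _ _ _ x hQP hPV hQV i)
  have hcoeff : (T X i j).coeff (p - r) = C (t i j r) := by
    simp only [T, levelEval, ι, RingHom.comp_apply, finsetSum_coeff, coeff_C_mul_X_pow]
    rw [Finset.sum_eq_single_of_mem r (Finset.mem_range_succ_iff.2 hr)]
    · simp
    · intro b hb hbr
      rw [if_neg]
      have := Finset.mem_range_succ_iff.1 hb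
      omega
  have hC := congrArg (fun P => (P.coeff (p - r)).coeff n) (sub_eq_zero.1 hcomm)
  simp only [coeff_mul_C, coeff_C_mul, hcoeff] at hC
  exact hC

end LevelPolynomial

section Yangian

variable {K : Type} [Field K] {p : ℕ}

theorem tF_succ (i j : Fin 2) (k : Fin p) :
    tF K p i j (k + 1) = FreeAlgebra.ι K (i, j, k) := by
  simp [tF, k.isLt]

theorem tY_zero (i j : Fin 2) : tY K p i j 0 = if i = j then 1 else 0 := by
  unfold tY tF
  simp only [dite_true]
  split_ifs <;> simp

theorem tY_eq_zero_of_lt (i j : Fin 2) {r : ℕ} (h : p < r) : tY K p i j r = 0 := by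
  have h0 : r ≠ 0 := by omega
  simp [tY, tF, h0, not_le.2 h]

theorem commute_tY_zero (i j : Fin 2) (x : Yp K p) : Commute (tY K p i j 0) x := by
  rw [tY_zero]
  split_ifs
  · exact Commute.one_left x
  · exact Commute.zero_left x

/-- The defining relations hold for all superscripts, including `0` and those above the level. -/
theorem tY_commutator (i j k l : Fin 2) (r s : ℕ) :
    tY K p i j r * tY K p k l s - tY K p k l s * tY K p i j r =
      ∑ a ∈ Finset.Icc 1 (min r s),
        (tY K p k j (a - 1) * tY K p i l (r + s - a)
          - tY K p k j (r + s - a) * tY K p i l (a - 1)) := by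
  rcases Nat.eq_zero_or_pos r with rfl | hr
  · simp [(commute_tY_zero i j (tY K p k l s)).eq]
  rcases Nat.eq_zero_or_pos s with rfl | hs
  · simp [(commute_tY_zero k l (tY K p i j r)).eq]
  by_cases h : r ≤ p ∧ s ≤ p
  · simpa [tY] using RingQuot.mkAlgHom_rel K (YRel.rel (K := K) i j k l r s hr h.1 hs h.2)
  · have hlhs : tY K p i j r = 0 ∨ tY K p k l s = 0 := by
      rcases not_and_or.1 h with h | h
      · exact Or.inl (tY_eq_zero_of_lt i j (not_le.1 h))
      · exact Or.inr (tY_eq_zero_of_lt k l (not_le.1 h))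
    rw [Finset.sum_eq_zero]
    · rcases hlhs with h | h <;> simp [h]
    · intro a ha
      have ha := Finset.mem_Icc.1 ha
      have hlt : p < r + s - a := by omega
      simp [tY_eq_zero_of_lt _ _ hlt]

theorem tY_commutator_comm (i j k l : Fin 2) (r s : ℕ) :
    tY K p i j r * tY K p k l s - tY K p k l s * tY K p i j r =
      tY K p i j s * tY K p k l r - tY K p k l r * tY K p i j s := by
  rw [tY_commutator, tY_commutator, min_comm, add_comm]

theorem tY_commutator_succ_sub (i j k l : Fin 2) (r s : ℕ) :
    (tY K p i j (r + 1) * tY K p k l s - tY K p k l s * tY K p i j (r + 1)) -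
      (tY K p i j r * tY K p k l (s + 1) - tY K p k l (s + 1) * tY K p i j r) =
      tY K p k j r * tY K p i l s - tY K p k j s * tY K p i l r := by
  simp only [tY_commutator]
  have hN : r + 1 + s = r + (s + 1) := by ring
  rw [hN]
  rcases lt_trichotomy r s with h | rfl | h
  · rw [min_eq_left (by omega : r + 1 ≤ s), min_eq_left (by omega : r ≤ s + 1),
      Finset.sum_Icc_succ_top (by omega), add_sub_cancel_left]
    simp [show r + (s + 1) - (r + 1) = s by omega]
  · simp
  · rw [min_eq_right (by omega : s ≤ r + 1), min_eq_right (by omega : s + 1 ≤ r),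
      Finset.sum_Icc_succ_top (by omega), sub_add_cancel_left]
    simp [show r + (s + 1) - (s + 1) = r by omega]

/-- The transposition `t_{ij}^{(r)} ↦ t_{ji}^{(r)}` on the free algebra, with values in the
opposite Yangian. -/
noncomputable def transposeFree (K : Type) [Field K] (p : ℕ) :
    FreeAlgebra K (YGen p) →ₐ[K] (Yp K p)ᵐᵒᵖ :=
  FreeAlgebra.lift K fun g => MulOpposite.op (tY K p g.2.1 g.1 (g.2.2 + 1))

theorem transposeFree_tF (i j : Fin 2) (r : ℕ) :
    transposeFree K p (tF K p i j r) = MulOpposite.op (tY K p j i r) := by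
  rcases Nat.eq_zero_or_pos r with rfl | hr
  · rw [tY_zero]
    simp only [tF, dite_true, eq_comm (a := j)]
    split_ifs <;> simp
  by_cases h : r ≤ p
  · simp [tF, hr.ne', h, transposeFree, Nat.sub_add_cancel hr]
  · rw [tY_eq_zero_of_lt _ _ (not_le.1 h)]
    simp [tF, hr.ne', h]

/-- The transposition anti-endomorphism of the Yangian. -/
noncomputable def transposeHom (K : Type) [Field K] (p : ℕ) : Yp K p →ₐ[K] (Yp K p)ᵐᵒᵖ :=
  RingQuot.liftAlgHom K ⟨transposeFree K p, by
    rintro _ _ ⟨i, j, k, l, r, s, -, -, -, -⟩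
    simp only [map_sub, map_mul, map_sum, transposeFree_tF, ← MulOpposite.op_mul,
      ← MulOpposite.op_sub, ← Finset.op_sum]
    rw [tY_commutator, min_comm]
    congr 1
    refine Finset.sum_congr rfl fun a _ => ?_
    have h := tY_commutator_comm (K := K) (p := p) j k l i (a - 1) (r + s - a)
    rw [add_comm s r]
    rw [sub_eq_sub_iff_add_eq_add] at h ⊢
    rw [add_comm (tY K p l i (r + s - a) * _), h, add_comm]⟩

@[simp]
theorem transposeHom_tY (i j : Fin 2) (r : ℕ) :
    transposeHom K p (tY K p i j r) = MulOpposite.op (tY K p j i r) := by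
  rw [transposeHom, tY, RingQuot.liftAlgHom_mkAlgHom_apply, transposeFree_tF]

theorem algHom_ext_tY {A : Type*} [Semiring A] [Algebra K A] {f g : Yp K p →ₐ[K] A}
    (h : ∀ i j r, f (tY K p i j r) = g (tY K p i j r)) : f = g := by
  refine RingQuot.ringQuot_ext' K f g (FreeAlgebra.hom_ext (funext fun ⟨i, j, k⟩ => ?_))
  simpa [tY, tF_succ] using h i j (k + 1)

theorem unop_transposeHom_transposeHom (x : Yp K p) :
    (transposeHom K p (transposeHom K p x).unop).unop = x := by
  have h : (AlgHom.opComm (transposeHom K p)).comp (transposeHom K p) = AlgHom.id K _ :=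
    algHom_ext_tY fun i j r => by simp
  exact DFunLike.congr_fun h x

/-- The transposition anti-automorphism of the Yangian. -/
noncomputable def transposeEquiv (K : Type) [Field K] (p : ℕ) : Yp K p ≃ₐ[K] (Yp K p)ᵐᵒᵖ :=
  AlgEquiv.ofBijective (transposeHom K p)
    ⟨fun x y h => by
      rw [← unop_transposeHom_transposeHom x, h, unop_transposeHom_transposeHom],
    fun y => ⟨(transposeHom K p y.unop).unop,
      MulOpposite.unop_injective (unop_transposeHom_transposeHom y.unop)⟩⟩

theorem TY_eq_levelEval (i j : Fin 2) : TY K p i j = levelEval C p (tY K p i j) X := by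
  rw [levelEval, Finset.sum_range_succ', TY, add_comm, Finset.range_eq_Ico,
    Finset.sum_Ico_add' (fun k => C (tY K p i j k) * X ^ (p - k)) 0 p 1, tY_zero]
  congr 1
  split_ifs <;> simp

theorem transposeHom_dY (i : ℕ) :
    transposeHom K p (dY K p i) = MulOpposite.op (dY K p i) := by
  unfold dY DY
  simp only [TY_eq_levelEval, levelEval_C_X_comp]
  exact map_coeff_qdet (transposeHom K p : Yp K p →+* (Yp K p)ᵐᵒᵖ) p
    (transposeHom_tY 0 0) (transposeHom_tY 1 1) (transposeHom_tY 1 0) (transposeHom_tY 0 1)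
    (commute_tY_zero 0 0) (tY_eq_zero_of_lt 0 0 (Nat.lt_succ_self p))
    (commute_tY_zero 1 1) (tY_eq_zero_of_lt 1 1 (Nat.lt_succ_self p))
    (tY_commutator_succ_sub 0 0 1 1) _

theorem commute_tY_dY (i j : Fin 2) (r m : ℕ) : Commute (tY K p i j r) (dY K p m) := by
  rcases le_or_gt r p with hr | hr
  · unfold dY DY
    simp only [TY_eq_levelEval, levelEval_C_X_comp]
    exact commute_coeff_qdet p (tY K p) commute_tY_zero
      (fun i j => tY_eq_zero_of_lt i j (Nat.lt_succ_self p)) tY_commutator_succ_sub i j hr _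
  · rw [tY_eq_zero_of_lt _ _ hr]
    exact Commute.zero_left _

/-- The coefficients of the quantum determinant are central. -/
theorem commute_dY (m : ℕ) (x : Yp K p) : Commute (dY K p m) x := by
  obtain ⟨y, rfl⟩ := RingQuot.mkAlgHom_surjective K (YRel K p) x
  induction y using FreeAlgebra.induction with
  | grade0 r => rw [AlgHom.commutes]; exact Algebra.commutes' r _ |>.symm
  | grade1 g =>
    obtain ⟨i, j, k⟩ := g
    rw [← tF_succ, ← tY]
    exact (commute_tY_dY i j _ m).symm
  | mul a b ha hb => rw [map_mul]; exact ha.mul_right hb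
  | add a b ha hb => rw [map_add]; exact ha.add_right hb

theorem commute_tY_tY_self (i j : Fin 2) (r s : ℕ) :
    Commute (tY K p i j r) (tY K p i j s) := by
  induction r generalizing s with
  | zero => exact commute_tY_zero i j _
  | succ r ih =>
    have h := tY_commutator_succ_sub (K := K) (p := p) i j i j r s
    rw [(ih (s + 1)).eq, (ih s).eq, sub_self, sub_zero, sub_self] at h
    exact sub_eq_zero.1 h

theorem commute_of_mem_Gam {x y : Yp K p} (hx : x ∈ Gam K p) (hy : y ∈ Gam K p) :
    Commute x y := by
  refine Algebra.commute_of_mem_adjoin_of_forall_mem_commute hy fun b hb => Commute.symm ?_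
  refine Algebra.commute_of_mem_adjoin_of_forall_mem_commute hx fun a ha => ?_
  rcases hb with ⟨s, -, rfl⟩ | ⟨m, -, rfl⟩
  · rcases ha with ⟨r, -, rfl⟩ | ⟨m, -, rfl⟩
    · exact commute_tY_tY_self 1 1 s r
    · exact (commute_dY m _).symm
  · exact commute_dY m a

theorem transposeHom_of_mem_Gam {x : Yp K p} (hx : x ∈ Gam K p) :
    transposeHom K p x = MulOpposite.op x := by
  induction hx using Algebra.adjoin_induction with
  | mem x hx =>
    rcases hx with ⟨k, -, rfl⟩ | ⟨i, -, rfl⟩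
    · exact transposeHom_tY 1 1 k
    · exact transposeHom_dY i
  | algebraMap r => exact (transposeHom K p).commutes r
  | add x y _ _ hx hy => rw [map_add, hx, hy, MulOpposite.op_add]
  | mul x y hx' hy' hx hy =>
    rw [map_mul, hx, hy, ← MulOpposite.op_mul, (commute_of_mem_Gam hx' hy').eq]

end Yangian

/-- The map `t_(ij)^(r) ↦ t_(ji)^(r)` extends to an anti-automorphism of `Y_p(gl_2)`
(an algebra isomorphism onto the opposite algebra), and every element of `Γ` is fixed
by it. -/
theorem transpose_antiautomorphism (K : Type) [Field K] (p : ℕ) :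
    ∃ φ : Yp K p ≃ₐ[K] (Yp K p)ᵐᵒᵖ,
      (∀ (i j : Fin 2) (r : ℕ), φ (tY K p i j r) = MulOpposite.op (tY K p j i r)) ∧
      ∀ x ∈ Gam K p, φ x = MulOpposite.op x := by
  exact ⟨transposeEquiv K p, transposeHom_tY, fun x hx => transposeHom_of_mem_Gam hx⟩
end
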